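/- Let m, n, N ∈ ℕ with n ≥ 2. Assume that K is a compact polynomially convex set in ℂⁿ, that a₁,…,a_s are finitely many points in K, that p and q are points in ℂⁿ \ K, and that P : ℂⁿ → ℂⁿ is a polynomial map with P(0) = 0 whose derivative at 0 is an invertible linear map. Then for every ε > 0 there exists a holomorphic automorphism Φ of ℂⁿ such that: (i) Φ(p) = q and Φ(z) − q − P(z − p) = O(‖z − p‖^{m+1}) as z → p; (ii) Φ(z) − z = O(‖z − a_j‖^{N}) as z → a_j for each j = 1,…,s; and (iii) ‖Φ(z) − z‖ + ‖Φ⁻¹(z) − z‖ < ε for every z ∈ K. -/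

import Mathlib

open Asymptotics Filter

noncomputable section

/-- The polynomial hull of a set K ⊆ ℂⁿ. -/
def polyHull {n : ℕ} (K : Set (EuclideanSpace ℂ (Fin n))) : Set (EuclideanSpace ℂ (Fin n)) :=
  {z | ∀ p : MvPolynomial (Fin n) ℂ, ∀ c : ℝ,
    (∀ w ∈ K, ‖MvPolynomial.eval (fun i => w i) p‖ ≤ c) →
      ‖MvPolynomial.eval (fun i => z i) p‖ ≤ c}

/-- A compact set is polynomially convex if it equals its polynomial hull. -/
def IsPolynomiallyConvex {n : ℕ} (K : Set (EuclideanSpace ℂ (Fin n))) : Prop :=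
  polyHull K = K

section Automorphisms

open Topology
open scoped ContDiff

variable {E F : Type*} [NormedAddCommGroup E] [NormedSpace ℂ E]
  [NormedAddCommGroup F] [NormedSpace ℂ F] {ι : Type*}

lemma fixed_of_isBigO {σ : E → E} {a : E} {N : ℕ}
    (h : (fun z => σ z - z) =O[𝓝 a] fun z => ‖z - a‖ ^ (N + 1)) : σ a = a := by
  obtain ⟨C, hC⟩ := h.bound
  have := hC.self_of_nhds
  simpa [sub_eq_zero] using this

/-- The group of biholomorphic automorphisms of `E` that agree with the identity
to order `N` at every point `a i`. -/
def jetAut (a : ι → E) (N : ℕ) : Subgroup (Equiv.Perm E) where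
  carrier := {σ | ContDiff ℂ ω (σ : E → E) ∧ ContDiff ℂ ω (σ⁻¹ : Equiv.Perm E) ∧
    ∀ i, (fun z => σ z - z) =O[𝓝 (a i)] fun z => ‖z - a i‖ ^ (N + 1)}
  one_mem' := by
    refine ⟨contDiff_id, contDiff_id, fun i => ?_⟩
    simpa using isBigO_zero _ _
  mul_mem' := by
    rintro σ τ ⟨hσ, hσ', hσj⟩ ⟨hτ, hτ', hτj⟩
    refine ⟨hσ.comp hτ, hτ'.comp hσ', fun i => ?_⟩
    have ht : τ (a i) = a i := fixed_of_isBigO (hτj i)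
    have hc : Tendsto τ (𝓝 (a i)) (𝓝 (a i)) := by
      simpa [ht] using hτ.continuous.tendsto (a i)
    have h1 := (hσj i).comp_tendsto hc
    have h2 : (fun z => τ z - a i) =O[𝓝 (a i)] fun z => z - a i := by
      simpa [ht] using ((hτ.differentiable (by simp)) (a i)).isBigO_sub
    have h3 := h1.trans (h2.norm_norm.pow (N + 1))
    refine (h3.add (hτj i)).congr_left fun z => ?_
    simp
  inv_mem' := by
    rintro σ ⟨hσ, hσ', hσj⟩
    refine ⟨hσ', by simpa using hσ, fun i => ?_⟩
    have ht : σ⁻¹ (a i) = a i := by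
      rw [Equiv.Perm.inv_eq_iff_eq]; exact (fixed_of_isBigO (hσj i)).symm
    have hc : Tendsto (σ⁻¹ : Equiv.Perm E) (𝓝 (a i)) (𝓝 (a i)) := by
      simpa only [ht] using hσ'.continuous.tendsto (a i)
    have h1 := (hσj i).comp_tendsto hc
    have h2 : (fun z => σ⁻¹ z - a i) =O[𝓝 (a i)] fun z => z - a i := by
      simpa only [ht] using ((hσ'.differentiable (by simp)) (a i)).isBigO_sub
    have h3 := h1.trans (h2.norm_norm.pow (N + 1))
    refine h3.neg_left.congr_left fun z => ?_
    simp

lemma jetAut.contDiff {a : ι → E} {N : ℕ} {σ : Equiv.Perm E} (h : σ ∈ jetAut a N) :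
    ContDiff ℂ ω σ := h.1

lemma jetAut.contDiff_inv {a : ι → E} {N : ℕ} {σ : Equiv.Perm E} (h : σ ∈ jetAut a N) :
    ContDiff ℂ ω (σ⁻¹ : Equiv.Perm E) := h.2.1

lemma jetAut.isBigO {a : ι → E} {N : ℕ} {σ : Equiv.Perm E} (h : σ ∈ jetAut a N) (i : ι) :
    (fun z => σ z - z) =O[𝓝 (a i)] fun z => ‖z - a i‖ ^ (N + 1) := h.2.2 i

/-- A shear along `u`, as an automorphism. -/
lemma exists_shear {a : ι → E} {N : ℕ} {f : E → ℂ} {u : E} (hf : ContDiff ℂ ω f)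
    (hinv : ∀ z (s : ℂ), f (z + s • u) = f z)
    (hjet : ∀ i, f =O[𝓝 (a i)] fun z => ‖z - a i‖ ^ (N + 1)) :
    ∃ σ ∈ jetAut a N, (∀ z, σ z = z + f z • u) ∧ ∀ z, σ⁻¹ z = z - f z • u := by
  have hinv' : ∀ z (s : ℂ), f (z - s • u) = f z := fun z s => by
    simpa [sub_eq_add_neg] using hinv z (-s)
  let σ : Equiv.Perm E :=
    ⟨fun z => z + f z • u, fun z => z - f z • u, fun z => by simp [hinv],
      fun z => by simp [hinv']⟩
  refine ⟨σ, ⟨?_, ?_, fun i => ?_⟩, fun z => rfl, fun z => rfl⟩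
  · change ContDiff ℂ ω fun z => z + f z • u
    fun_prop
  · change ContDiff ℂ ω fun z => z - f z • u
    fun_prop
  · have : (fun z => σ z - z) = fun z => f z • u := by
      funext z
      change z + f z • u - z = _
      abel
    rw [this]
    simpa using (hjet i).smul (isBigO_const_const u (one_ne_zero (α := ℝ)) _)

/-- An overshear along `u`, as an automorphism. -/
lemma exists_overshear {a : ι → E} {N : ℕ} {f l : E → ℂ} {u : E} (hf : ContDiff ℂ ω f)
    (hl : ContDiff ℂ ω l) (hinv : ∀ z (s : ℂ), f (z + s • u) = f z)
    (hlu : ∀ z (s : ℂ), l (z + s • u) = l z + s)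
    (hjet : ∀ i, f =O[𝓝 (a i)] fun z => ‖z - a i‖ ^ (N + 1)) :
    ∃ σ ∈ jetAut a N, (∀ z, σ z = z + ((Complex.exp (f z) - 1) * l z) • u) ∧
      ∀ z, σ⁻¹ z = z + ((Complex.exp (-f z) - 1) * l z) • u := by
  let σ : Equiv.Perm E :=
    ⟨fun z => z + ((Complex.exp (f z) - 1) * l z) • u,
      fun z => z + ((Complex.exp (-f z) - 1) * l z) • u, fun z => by
        have := Complex.exp_neg (f z)
        have h0 := Complex.exp_ne_zero (f z)
        simp only [hinv, hlu, add_assoc, ← add_smul]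
        rw [this]
        convert add_zero z
        convert zero_smul ℂ u
        field_simp
        ring,
      fun z => by
        have := Complex.exp_neg (f z)
        have h0 := Complex.exp_ne_zero (f z)
        simp only [hinv, hlu, add_assoc, ← add_smul]
        rw [this]
        convert add_zero z
        convert zero_smul ℂ u
        field_simp
        ring⟩
  refine ⟨σ, ⟨?_, ?_, fun i => ?_⟩, fun z => rfl, fun z => rfl⟩
  · change ContDiff ℂ ω fun z => z + ((Complex.exp (f z) - 1) * l z) • u
    fun_prop
  · change ContDiff ℂ ω fun z => z + ((Complex.exp (-f z) - 1) * l z) • u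
    fun_prop
  · have : (fun z => σ z - z) = fun z => ((Complex.exp (f z) - 1) * l z) • u := by
      funext z
      change z + _ - z = _
      abel
    rw [this]
    have h0 : f (a i) = 0 := by
      obtain ⟨C, hC⟩ := (hjet i).bound
      simpa using hC.self_of_nhds
    have hc : Tendsto f (𝓝 (a i)) (𝓝 0) := by
      simpa [h0] using hf.continuous.tendsto (a i)
    have h1 : (fun z => Complex.exp (f z) - 1) =O[𝓝 (a i)] f := by
      have := (Complex.hasDerivAt_exp 0).differentiableAt.isBigO_sub.comp_tendsto hc
      simpa [Function.comp_def] using this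
    have h2 : l =O[𝓝 (a i)] fun _ => (1 : ℝ) :=
      (hl.continuous.tendsto (a i)).isBigO_one ℝ
    simpa using ((h1.trans (hjet i)).mul h2).smul (isBigO_const_const u (one_ne_zero (α := ℝ)) _)

/-- `σ` and its inverse are `ε`-close to the identity on `L`. -/
def CloseToId (L : Set E) (ε : ℝ) (σ : Equiv.Perm E) : Prop :=
  ∀ z ∈ L, ‖σ z - z‖ < ε ∧ ‖σ⁻¹ z - z‖ < ε

lemma CloseToId.inv {L : Set E} {ε : ℝ} {σ : Equiv.Perm E} (h : CloseToId L ε σ) :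
    CloseToId L ε σ⁻¹ := fun z hz => ⟨(h z hz).2, by simpa using (h z hz).1⟩

lemma CloseToId.mono {L L' : Set E} {ε ε' : ℝ} {σ : Equiv.Perm E} (h : CloseToId L ε σ)
    (hL : L' ⊆ L) (hε : ε ≤ ε') : CloseToId L' ε' σ :=
  fun z hz => ⟨(h z (hL hz)).1.trans_le hε, (h z (hL hz)).2.trans_le hε⟩

lemma exists_closeToId_mul [ProperSpace E] {U L : Set E} (hU : IsOpen U) (hL : IsCompact L)
    (hLU : L ⊆ U) {ε : ℝ} (hε : 0 < ε) :
    ∃ L' ⊆ U, IsCompact L' ∧ ∃ δ > 0, ∀ σ τ : Equiv.Perm E, CloseToId L' δ σ →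
      CloseToId L' δ τ → CloseToId L ε (σ * τ) := by
  obtain ⟨δ, hδ, hδU⟩ := hL.exists_cthickening_subset_open hU hLU
  refine ⟨_, hδU, hL.cthickening, min δ (ε / 2), by positivity, fun σ τ hσ hτ z hz => ?_⟩
  have hmem : ∀ w, ‖w - z‖ < min δ (ε / 2) → w ∈ Metric.cthickening δ L := fun w hw =>
    Metric.mem_cthickening_of_dist_le w z δ L hz
      (by rw [dist_eq_norm]; exact (hw.trans_le (min_le_left _ _)).le)
  have hz' := Metric.self_subset_cthickening L hz (δ := δ)
  have key : ∀ σ τ : Equiv.Perm E, CloseToId (Metric.cthickening δ L) (min δ (ε / 2)) σ →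
      CloseToId (Metric.cthickening δ L) (min δ (ε / 2)) τ → ‖σ (τ z) - z‖ < ε := by
    intro σ τ hσ hτ
    have h1 := (hτ z hz').1
    have h2 := (hσ (τ z) (hmem _ h1)).1
    have h3 : σ (τ z) - z = (σ (τ z) - τ z) + (τ z - z) := by abel
    rw [h3]
    have := min_le_right δ (ε / 2)
    refine (norm_add_le _ _).trans_lt (by linarith)
  refine ⟨key σ τ hσ hτ, ?_⟩
  rw [mul_inv_rev]
  exact key _ _ hτ.inv hσ.inv

/-- Property `T` is realized by elements of `G` arbitrarily close to the identity on compact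
subsets of `U`. -/
def NearId (G : Subgroup (Equiv.Perm E)) (U : Set E) (T : Equiv.Perm E → Prop) : Prop :=
  ∀ L ⊆ U, IsCompact L → ∀ ε > 0, ∃ σ ∈ G, T σ ∧ CloseToId L ε σ

lemma NearId.mono {G : Subgroup (Equiv.Perm E)} {U : Set E} {T T' : Equiv.Perm E → Prop}
    (h : NearId G U T) (hT : ∀ σ ∈ G, T σ → T' σ) : NearId G U T' := by
  intro L hLU hL ε hε
  obtain ⟨σ, hσ, h1, h2⟩ := h L hLU hL ε hε
  exact ⟨σ, hσ, hT σ hσ h1, h2⟩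

lemma NearId.inv {G : Subgroup (Equiv.Perm E)} {U : Set E} {T : Equiv.Perm E → Prop}
    (h : NearId G U T) : NearId G U fun σ => T σ⁻¹ := by
  intro L hLU hL ε hε
  obtain ⟨σ, hσ, h1, h2⟩ := h L hLU hL ε hε
  exact ⟨σ⁻¹, G.inv_mem hσ, by simpa using h1, h2.inv⟩

lemma NearId.mul [ProperSpace E] {G : Subgroup (Equiv.Perm E)} {U : Set E} (hU : IsOpen U)
    {T₁ T : Equiv.Perm E → Prop} {T₂ : Equiv.Perm E → Equiv.Perm E → Prop} (h₁ : NearId G U T₁)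
    (h₂ : ∀ σ ∈ G, T₁ σ → NearId G U (T₂ σ))
    (h : ∀ σ ∈ G, ∀ τ ∈ G, T₁ σ → T₂ σ τ → T (τ * σ)) : NearId G U T := by
  intro L hLU hL ε hε
  obtain ⟨L', hL'U, hL', δ, hδ, hmul⟩ := exists_closeToId_mul hU hL hLU hε
  obtain ⟨σ, hσ, h1, h2⟩ := h₁ L' hL'U hL' δ hδ
  obtain ⟨τ, hτ, h3, h4⟩ := h₂ σ hσ h1 L' hL'U hL' δ hδ
  exact ⟨τ * σ, G.mul_mem hτ hσ, h σ hσ τ hτ h1 h3, hmul τ σ h4 h2⟩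

end Automorphisms

section Fields

open Topology
open scoped ContDiff

variable {E F : Type*} [NormedAddCommGroup E] [NormedSpace ℂ E]
  [NormedAddCommGroup F] [NormedSpace ℂ F] {ι : Type*}

/-- First-order expansion in the first variable, uniformly on compact sets. -/
lemma eventually_norm_sub_le_of_contDiff {c : ℂ × E → F} (hc : ContDiff ℂ ω c) {X : E → F}
    (hX : ∀ z, HasDerivAt (fun t => c (t, z)) (X z) 0) {L : Set E} (hL : IsCompact L)
    {η : ℝ} (hη : 0 < η) :
    ∀ᶠ t : ℂ in 𝓝 0, ∀ z ∈ L, ‖c (t, z) - c (0, z) - t • X z‖ ≤ η * ‖t‖ := by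
  have hcont : Continuous fun y => fderiv ℂ c y (1, 0) :=
    (hc.continuous_fderiv (by simp)).clm_apply continuous_const
  have hder : ∀ t z, HasDerivAt (fun t => c (t, z)) (fderiv ℂ c (t, z) (1, 0)) t := by
    intro t z
    have h1 : HasFDerivAt c (fderiv ℂ c (t, z)) (t, z) :=
      (hc.differentiable (by simp) _).hasFDerivAt
    have h2 : HasDerivAt (fun t : ℂ => (t, z)) ((1 : ℂ), (0 : E)) t :=
      (hasDerivAt_id t).prodMk (hasDerivAt_const t z)
    exact h1.comp_hasDerivAt t h2
  have hX' : ∀ z, X z = fderiv ℂ c (0, z) (1, 0) := fun z => (hX z).unique (hder 0 z)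
  have huni : ∀ᶠ t : ℂ in 𝓝 0, ∀ z ∈ L, ‖fderiv ℂ c (t, z) (1, 0) - X z‖ < η := by
    refine hL.eventually_forall_of_forall_eventually
      (P := fun t z => ‖fderiv ℂ c (t, z) (1, 0) - X z‖ < η) fun z _ => ?_
    have h1 : Continuous fun y : ℂ × E =>
        ‖fderiv ℂ c y (1, 0) - fderiv ℂ c (0, y.2) (1, 0)‖ :=
      (hcont.sub (hcont.comp (continuous_const.prodMk continuous_snd))).norm
    have h2 := h1.tendsto (0, z)
    simp only [sub_self, norm_zero] at h2
    filter_upwards [h2.eventually (gt_mem_nhds hη)] with y hy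
    rw [hX']
    exact hy
  obtain ⟨δ, hδ, h⟩ := Metric.eventually_nhds_iff_ball.mp huni
  refine Metric.eventually_nhds_iff_ball.mpr ⟨δ, hδ, fun t ht z hz => ?_⟩
  have := (convex_ball (0 : ℂ) δ).norm_image_sub_le_of_norm_hasDerivWithin_le
    (f := fun t => c (t, z) - t • X z) (f' := fun t => fderiv ℂ c (t, z) (1, 0) - X z) (C := η)
    (fun s _ => (by
      simpa using ((hder s z).fun_sub ((hasDerivAt_id s).smul_const (X z))).hasDerivWithinAt))
    (fun s hs => (h s hs z hz).le) (Metric.mem_ball_self hδ) ht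
  simpa [sub_right_comm] using this

/-- The vector field `X` is, locally uniformly, arbitrarily well approximated to first order by
elements of `G`. -/
def Approximable (G : Subgroup (Equiv.Perm E)) (X : E → E) : Prop :=
  Continuous X ∧ ∀ L, IsCompact L → ∀ η > 0, ∀ᶠ t : ℝ in 𝓝[>] 0, ∃ σ ∈ G, ∀ z ∈ L,
    ‖σ z - z - (t : ℂ) • X z‖ ≤ η * t ∧ ‖σ⁻¹ z - z + (t : ℂ) • X z‖ ≤ η * t

lemma tendsto_ofReal_nhdsGT_zero : Tendsto (fun t : ℝ => (t : ℂ)) (𝓝[>] 0) (𝓝 0) := by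
  have := (Complex.continuous_ofReal.tendsto 0).mono_left (nhdsWithin_le_nhds (s := Set.Ioi 0))
  simpa using this

lemma Approximable.of_flow {G : Subgroup (Equiv.Perm E)} {c : ℂ × E → E}
    (hc : ContDiff ℂ ω c) (h0 : ∀ z, c (0, z) = z)
    (hG : ∀ t, ∃ σ ∈ G, (∀ z, σ z = c (t, z)) ∧ ∀ z, σ⁻¹ z = c (-t, z)) {X : E → E}
    (hXc : Continuous X) (hX : ∀ z, HasDerivAt (fun t => c (t, z)) (X z) 0) :
    Approximable G X := by
  refine ⟨hXc, fun L hL η hη => ?_⟩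
  have h1 := eventually_norm_sub_le_of_contDiff hc hX hL hη
  have h2 := (show Tendsto (fun t : ℂ => -t) (𝓝 0) (𝓝 0) by
    simpa using (continuous_neg (G := ℂ)).tendsto 0).eventually h1
  filter_upwards [tendsto_ofReal_nhdsGT_zero.eventually h1,
    tendsto_ofReal_nhdsGT_zero.eventually h2, self_mem_nhdsWithin] with t h3 h4 ht
  have ht : 0 < t := ht
  obtain ⟨σ, hσ, hσ1, hσ2⟩ := hG t
  refine ⟨σ, hσ, fun z hz => ⟨?_, ?_⟩⟩
  · simpa [hσ1, h0, abs_of_pos ht] using h3 z hz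
  · simpa [hσ2, h0, abs_of_pos ht] using h4 z hz

lemma Approximable.neg {G : Subgroup (Equiv.Perm E)} {X : E → E} (h : Approximable G X) :
    Approximable G fun z => -X z := by
  refine ⟨h.1.neg, fun L hL η hη => ?_⟩
  filter_upwards [h.2 L hL η hη] with t ⟨σ, hσ, hz⟩
  refine ⟨σ⁻¹, G.inv_mem hσ, fun z hzL => ⟨?_, ?_⟩⟩
  · simpa using (hz z hzL).2
  · simpa [sub_eq_add_neg] using (hz z hzL).1

lemma Approximable.of_forall_close {G : Subgroup (Equiv.Perm E)} {X : E → E} (hX : Continuous X)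
    (h : ∀ L, IsCompact L → ∀ η > 0, ∃ Y, Approximable G Y ∧ ∀ z ∈ L, ‖Y z - X z‖ ≤ η) :
    Approximable G X := by
  refine ⟨hX, fun L hL η hη => ?_⟩
  obtain ⟨Y, hY, hYX⟩ := h L hL (η / 2) (by positivity)
  filter_upwards [hY.2 L hL (η / 2) (by positivity), self_mem_nhdsWithin] with t ⟨σ, hσ, hz⟩ ht
  have ht : 0 < t := ht
  have key : ∀ z ∈ L, ‖(t : ℂ) • (Y z - X z)‖ ≤ η / 2 * t := fun z hzL => by
    rw [norm_smul, Complex.norm_real, Real.norm_of_nonneg ht.le, mul_comm]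
    gcongr
    exact hYX z hzL
  refine ⟨σ, hσ, fun z hzL => ⟨?_, ?_⟩⟩
  · have e : σ z - z - (t : ℂ) • X z = (σ z - z - (t : ℂ) • Y z) + (t : ℂ) • (Y z - X z) := by
      module
    rw [e]
    exact (norm_add_le _ _).trans (by linarith [(hz z hzL).1, key z hzL])
  · have e : σ⁻¹ z - z + (t : ℂ) • X z
        = (σ⁻¹ z - z + (t : ℂ) • Y z) - (t : ℂ) • (Y z - X z) := by module
    rw [e]
    exact (norm_sub_le _ _).trans (by linarith [(hz z hzL).2, key z hzL])

lemma Approximable.smul_pos {G : Subgroup (Equiv.Perm E)} {X : E → E} (h : Approximable G X)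
    {r : ℝ} (hr : 0 < r) : Approximable G fun z => (r : ℂ) • X z := by
  refine ⟨h.1.const_smul _, fun L hL η hη => ?_⟩
  have h1 := h.2 L hL (η / r) (by positivity)
  have h2 : Tendsto (fun t : ℝ => r * t) (𝓝[>] 0) (𝓝[>] 0) := by
    refine tendsto_nhdsWithin_iff.mpr ⟨?_, ?_⟩
    · have := ((continuous_const_mul r).tendsto 0).mono_left
        (nhdsWithin_le_nhds (s := Set.Ioi 0))
      simpa using this
    · filter_upwards [self_mem_nhdsWithin] with t ht
      exact mul_pos hr ht
  filter_upwards [h2.eventually h1] with t ⟨σ, hσ, hz⟩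
  refine ⟨σ, hσ, fun z hzL => ?_⟩
  have e : η / r * (r * t) = η * t := by field_simp
  have := hz z hzL
  rw [e] at this
  simp only [smul_smul]
  rwa [mul_comm (t : ℂ), ← Complex.ofReal_mul]

lemma Approximable.add [ProperSpace E] {G : Subgroup (Equiv.Perm E)} {X Y : E → E}
    (hX : Approximable G X) (hY : Approximable G Y) : Approximable G fun z => X z + Y z := by
  refine ⟨hX.1.add hY.1, fun L hL η hη => ?_⟩
  have hL' : IsCompact (Metric.cthickening 1 L) := hL.cthickening
  have hLL' : L ⊆ Metric.cthickening 1 L := Metric.self_subset_cthickening L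
  have unif : ∀ Z : E → E, Continuous Z → ∃ δ > 0, ∀ z ∈ L, ∀ w, ‖w - z‖ < δ →
      ‖Z w - Z z‖ < η / 3 := by
    intro Z hZ
    have := hL.uniformContinuousAt_of_continuousAt Z (fun z _ => hZ.continuousAt)
      (Metric.dist_mem_uniformity (show 0 < η / 3 by positivity))
    obtain ⟨δ, hδ, h⟩ := Metric.mem_uniformity_dist.mp this
    refine ⟨δ, hδ, fun z hz w hw => ?_⟩
    have := h (a := z) (b := w) (by rwa [dist_comm, dist_eq_norm]) hz
    simpa [dist_eq_norm, norm_sub_rev] using this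
  have bdd : ∀ Z : E → E, Continuous Z → ∃ C > 0, ∀ z ∈ L, ‖Z z‖ ≤ C := by
    intro Z hZ
    obtain ⟨C, hC⟩ := hL.exists_bound_of_continuousOn hZ.continuousOn
    exact ⟨max C 1, by positivity, fun z hz => (hC z hz).trans (le_max_left _ _)⟩
  obtain ⟨δ₁, hδ₁, hu₁⟩ := unif X hX.1
  obtain ⟨δ₂, hδ₂, hu₂⟩ := unif Y hY.1
  obtain ⟨C₁, hC₁, hb₁⟩ := bdd X hX.1
  obtain ⟨C₂, hC₂, hb₂⟩ := bdd Y hY.1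
  have hsmall : ∀ᶠ t : ℝ in 𝓝[>] 0, (C₁ + C₂ + η) * t < min 1 (min δ₁ δ₂) := by
    have : Tendsto (fun t : ℝ => (C₁ + C₂ + η) * t) (𝓝[>] 0) (𝓝 0) := by
      have := ((continuous_const_mul (C₁ + C₂ + η)).tendsto 0).mono_left
        (nhdsWithin_le_nhds (s := Set.Ioi 0))
      simpa using this
    exact this.eventually (gt_mem_nhds (by positivity))
  filter_upwards [hX.2 _ hL' (η / 3) (by positivity), hY.2 _ hL' (η / 3) (by positivity),
    hsmall, self_mem_nhdsWithin] with t ⟨σ, hσ, hσz⟩ ⟨τ, hτ, hτz⟩ hs ht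
  have ht : 0 < t := ht
  have hnt : ‖(t : ℂ)‖ = t := by simp [abs_of_pos ht]
  have key : ∀ (σ τ : Equiv.Perm E) (A B : E → E) (δ C : ℝ), 
      (∀ z ∈ L, ∀ w, ‖w - z‖ < δ → ‖A w - A z‖ < η / 3) → (∀ z ∈ L, ‖B z‖ ≤ C) → 
      (C + η) * t < min 1 δ →
      (∀ z ∈ Metric.cthickening 1 L, ‖σ z - z - (t : ℂ) • A z‖ ≤ η / 3 * t) →
      (∀ z ∈ Metric.cthickening 1 L, ‖τ z - z - (t : ℂ) • B z‖ ≤ η / 3 * t) →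
      ∀ z ∈ L, ‖σ (τ z) - z - (t : ℂ) • (A z + B z)‖ ≤ η * t := by
    intro σ τ A B δ C hA hB hC hσ hτ z hz
    have h1 := hτ z (hLL' hz)
    have h2 : ‖(t : ℂ) • B z‖ ≤ C * t := by
      rw [norm_smul, hnt, mul_comm]
      gcongr
      exact hB z hz
    have h3 : ‖τ z - z‖ < min 1 δ := by
      have e : τ z - z = (τ z - z - (t : ℂ) • B z) + (t : ℂ) • B z := by abel
      rw [e]
      refine (norm_add_le _ _).trans_lt (lt_of_le_of_lt ?_ hC)
      have : 0 < η * t := by positivity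
      linarith
    have h4 : τ z ∈ Metric.cthickening 1 L :=
      Metric.mem_cthickening_of_dist_le _ z 1 L hz
        (by rw [dist_eq_norm]; exact (h3.trans_le (min_le_left _ _)).le)
    have h5 := hσ _ h4
    have h6 : ‖(t : ℂ) • (A (τ z) - A z)‖ ≤ η / 3 * t := by
      rw [norm_smul, hnt, mul_comm]
      gcongr
      exact (hA z hz _ (h3.trans_le (min_le_right _ _))).le
    have e : σ (τ z) - z - (t : ℂ) • (A z + B z) = (σ (τ z) - τ z - (t : ℂ) • A (τ z))
        + (τ z - z - (t : ℂ) • B z) + (t : ℂ) • (A (τ z) - A z) := by module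
    rw [e]
    refine (norm_add₃_le).trans (by linarith)
  have hle₁ : (C₂ + η) * t < min 1 δ₁ :=
    lt_of_le_of_lt (by gcongr; linarith) (hs.trans_le (min_le_min_left _ (min_le_left _ _)))
  have hle₂ : (C₁ + η) * t < min 1 δ₂ :=
    lt_of_le_of_lt (by gcongr; linarith) (hs.trans_le (min_le_min_left _ (min_le_right _ _)))
  refine ⟨σ * τ, G.mul_mem hσ hτ, fun z hz => ⟨?_, ?_⟩⟩
  · exact key σ τ X Y δ₁ C₂ hu₁ hb₂ hle₁ (fun z hz => (hσz z hz).1) (fun z hz => (hτz z hz).1) z hz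
  · have := key τ⁻¹ σ⁻¹ (fun z => -Y z) (fun z => -X z) δ₂ C₁
      (fun z hz w hw => by
        have := hu₂ z hz w hw
        rwa [← norm_neg, show -(-Y w - -Y z) = Y w - Y z by abel])
      (fun z hz => by simpa using hb₁ z hz) hle₂
      (fun z hz => by simpa using (hτz z hz).2) (fun z hz => by simpa using (hσz z hz).2) z hz
    rw [mul_inv_rev]
    convert this using 2
    rw [Equiv.Perm.mul_apply]
    module

lemma Approximable.sum [ProperSpace E] {G : Subgroup (Equiv.Perm E)} {κ : Type*}
    (s : Finset κ) {X : κ → E → E} (hX : ∀ i ∈ s, Approximable G (X i)) :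
    Approximable G fun z => ∑ i ∈ s, X i z := by
  classical
  induction s using Finset.induction_on with
  | empty =>
    refine ⟨by simpa using continuous_const, fun L hL η hη => ?_⟩
    filter_upwards [self_mem_nhdsWithin] with t ht
    have : 0 < t := ht
    exact ⟨1, G.one_mem, fun z _ => by simp; positivity⟩
  | insert i s hi ih =>
    simp only [Finset.sum_insert hi]
    exact (hX i (Finset.mem_insert_self i s)).add
      (ih fun j hj => hX j (Finset.mem_insert_of_mem hj))

end Fields

section Brackets

open Topology
open scoped ContDiff

variable {E F : Type*} [NormedAddCommGroup E] [NormedSpace ℂ E]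
  [NormedAddCommGroup F] [NormedSpace ℂ F] {ι : Type*}

/-- `Y` is a holomorphic vector field whose flow exists for all complex times and lies in `G`. -/
def IsCompleteField (G : Subgroup (Equiv.Perm E)) (Y : E → E) : Prop :=
  ContDiff ℂ ω Y ∧ ∃ c : ℂ × E → E, ContDiff ℂ ω c ∧ (∀ z, c (0, z) = z) ∧
    (∀ t, ∃ σ ∈ G, (∀ z, σ z = c (t, z)) ∧ ∀ z, σ⁻¹ z = c (-t, z)) ∧
    ∀ z, HasDerivAt (fun t => c (t, z)) (Y z) 0

lemma IsCompleteField.approximable {G : Subgroup (Equiv.Perm E)} {Y : E → E}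
    (h : IsCompleteField G Y) : Approximable G Y := by
  obtain ⟨hY, c, hc, h0, hG, hd⟩ := h
  exact .of_flow hc h0 hG hY.continuous hd

lemma isCompleteField_shear {a : ι → E} {N : ℕ} {f : E → ℂ} {u : E} (hf : ContDiff ℂ ω f)
    (hinv : ∀ z (s : ℂ), f (z + s • u) = f z)
    (hjet : ∀ i, f =O[𝓝 (a i)] fun z => ‖z - a i‖ ^ (N + 1)) :
    IsCompleteField (jetAut a N) fun z => f z • u := by
  refine ⟨by fun_prop, fun y => y.2 + (y.1 * f y.2) • u, by fun_prop, by simp, fun t => ?_,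
    fun z => ?_⟩
  · obtain ⟨σ, hσ, h1, h2⟩ := exists_shear (a := a) (N := N) (f := fun z => t * f z) (u := u)
      (by fun_prop) (by simp [hinv]) (fun i => (hjet i).const_mul_left t)
    exact ⟨σ, hσ, h1, fun z => by rw [h2]; simp [sub_eq_add_neg]⟩
  · simpa using (((hasDerivAt_id (0 : ℂ)).mul_const (f z)).smul_const u).const_add z

lemma isCompleteField_overshear {a : ι → E} {N : ℕ} {f l : E → ℂ} {u : E}
    (hf : ContDiff ℂ ω f) (hl : ContDiff ℂ ω l) (hinv : ∀ z (s : ℂ), f (z + s • u) = f z)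
    (hlu : ∀ z (s : ℂ), l (z + s • u) = l z + s)
    (hjet : ∀ i, f =O[𝓝 (a i)] fun z => ‖z - a i‖ ^ (N + 1)) :
    IsCompleteField (jetAut a N) fun z => (f z * l z) • u := by
  refine ⟨by fun_prop, fun y => y.2 + ((Complex.exp (y.1 * f y.2) - 1) * l y.2) • u,
    by fun_prop, by simp, fun t => ?_, fun z => ?_⟩
  · obtain ⟨σ, hσ, h1, h2⟩ := exists_overshear (a := a) (N := N) (f := fun z => t * f z)
      (l := l) (u := u) (by fun_prop) hl (by simp [hinv]) hlu
      (fun i => (hjet i).const_mul_left t)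
    exact ⟨σ, hσ, h1, fun z => by rw [h2]; simp⟩
  · have h1 := (((hasDerivAt_id (0 : ℂ)).mul_const (f z)).cexp.sub_const 1).mul_const (l z)
    simpa using (h1.smul_const u).const_add z

/-- The Lie bracket of a shear field with a complete field is approximable. -/
lemma approximable_bracket [ProperSpace E] {a : ι → E} {N : ℕ} {f : E → ℂ} {u : E}
    (hf : ContDiff ℂ ω f) (hinv : ∀ z (s : ℂ), f (z + s • u) = f z)
    (hjet : ∀ i, f =O[𝓝 (a i)] fun z => ‖z - a i‖ ^ (N + 1)) {Y : E → E}
    (hY : IsCompleteField (jetAut a N) Y) :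
    Approximable (jetAut a N) fun z => fderiv ℂ Y z (f z • u) - (fderiv ℂ f z (Y z)) • u := by
  have hYapp := hY.approximable
  obtain ⟨hYd, c, hc, h0, hG, hd⟩ := hY
  have hfd : ContDiff ℂ ω (fderiv ℂ f) := hf.fderiv_right (by simp)
  have hYdd : ContDiff ℂ ω (fderiv ℂ Y) := hYd.fderiv_right (by simp)
  let Z : ℂ × E → E := fun y => Y (y.2 + (y.1 * f y.2) • u) -
    (y.1 * fderiv ℂ f (y.2 + (y.1 * f y.2) • u) (Y (y.2 + (y.1 * f y.2) • u))) • u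
  have hZ : ContDiff ℂ ω Z := by
    have h1 : ContDiff ℂ ω fun y : ℂ × E => y.2 + (y.1 * f y.2) • u := by fun_prop
    exact (hYd.comp h1).sub ((contDiff_fst.mul ((hfd.comp h1).clm_apply (hYd.comp h1))).smul
      contDiff_const)
  have hZapp : ∀ s, Approximable (jetAut a N) fun z => Z (s, z) := by
    intro s
    refine .of_flow (c := fun y => c (y.1, y.2 + (s * f y.2) • u) -
      (s * f (c (y.1, y.2 + (s * f y.2) • u))) • u) ?_ ?_ ?_ ?_ ?_
    · fun_prop
    · intro z
      simp [h0, hinv]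
    · intro t
      obtain ⟨σ, hσ, h1, h2⟩ := hG t
      obtain ⟨ψ, hψ, h3, h4⟩ := exists_shear (a := a) (N := N) (f := fun z => s * f z) (u := u)
        (by fun_prop) (by simp [hinv]) (fun i => (hjet i).const_mul_left s)
      refine ⟨ψ⁻¹ * σ * ψ, mul_mem (mul_mem (inv_mem hψ) hσ) hψ, fun z => ?_, fun z => ?_⟩
      · simp only [Equiv.Perm.mul_apply, h3, h1, h4]
      · simp only [mul_inv_rev, inv_inv, Equiv.Perm.mul_apply, h3, h2, h4]
    · exact hZ.continuous.comp (by fun_prop)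
    · intro z
      have h1 := hd (z + (s * f z) • u)
      have h2 : HasDerivAt (fun t => f (c (t, z + (s * f z) • u)))
          (fderiv ℂ f (z + (s * f z) • u) (Y (z + (s * f z) • u))) 0 := by
        have := (hf.differentiable (by simp) (c (0, z + (s * f z) • u))).hasFDerivAt.comp_hasDerivAt
          (0 : ℂ) h1
        simpa only [h0, Function.comp_def] using this
      exact h1.sub ((h2.const_mul s).smul_const u)
  have hd0 : ∀ z, HasDerivAt (fun s => Z (s, z))
      (fderiv ℂ Y z (f z • u) - (fderiv ℂ f z (Y z)) • u) 0 := by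
    intro z
    have h1 : HasDerivAt (fun s : ℂ => z + (s * f z) • u) (f z • u) 0 := by
      simpa using (((hasDerivAt_id (0 : ℂ)).mul_const (f z)).smul_const u).const_add z
    have h2 : HasDerivAt (fun s : ℂ => Y (z + (s * f z) • u)) (fderiv ℂ Y z (f z • u)) 0 := by
      have := (hYd.differentiable (by simp) (z + ((0 : ℂ) * f z) • u)).hasFDerivAt.comp_hasDerivAt
          (0 : ℂ) h1
      simpa [Function.comp_def] using this
    have h3 : Differentiable ℂ fun s : ℂ =>
        fderiv ℂ f (z + (s * f z) • u) (Y (z + (s * f z) • u)) := by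
      have h4 : ContDiff ℂ ω fun s : ℂ => z + (s * f z) • u := by fun_prop
      exact ((hfd.comp h4).clm_apply (hYd.comp h4)).differentiable (by simp)
    have h5 := ((hasDerivAt_id (0 : ℂ)).fun_mul (h3 0).hasDerivAt).smul_const u
    simpa [Z] using h2.fun_sub h5
  refine .of_forall_close ?_ fun L hL η hη => ?_
  · exact ((hYdd.continuous.clm_apply (by have := hf.continuous; fun_prop)).sub
      ((hfd.continuous.clm_apply hYd.continuous).smul continuous_const))
  · obtain ⟨r, hr, hr0⟩ := ((tendsto_ofReal_nhdsGT_zero.eventually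
      (eventually_norm_sub_le_of_contDiff hZ hd0 hL hη)).and self_mem_nhdsWithin).exists
    have hr0 : 0 < r := hr0
    refine ⟨fun z => ((r⁻¹ : ℝ) : ℂ) • (Z (r, z) + -Y z),
      ((hZapp r).add hYapp.neg).smul_pos (inv_pos.mpr hr0), fun z hz => ?_⟩
    have h1 := hr z hz
    have h2 : Z (0, z) = Y z := by simp [Z]
    have hrc : (r : ℂ) ≠ 0 := by exact_mod_cast hr0.ne'
    rw [h2] at h1
    set W := fderiv ℂ Y z (f z • u) - (fderiv ℂ f z (Y z)) • u
    have e : ((r⁻¹ : ℝ) : ℂ) • (Z (r, z) + -Y z) - W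
        = ((r⁻¹ : ℝ) : ℂ) • (Z (r, z) - Y z - (r : ℂ) • W) := by
      rw [smul_sub _ _ ((r : ℂ) • W), smul_smul, ← Complex.ofReal_mul, inv_mul_cancel₀ hr0.ne',
        Complex.ofReal_one, one_smul, sub_eq_add_neg (Z _)]
    rw [e, norm_smul, Complex.norm_real, Real.norm_of_nonneg (by positivity)]
    rw [Complex.norm_real, Real.norm_of_nonneg hr0.le] at h1
    rw [inv_mul_le_iff₀ hr0]
    linarith

lemma approximable_mul_smul [ProperSpace E] {a : ι → E} {N : ℕ} {f g : E → ℂ} {u v : E}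
    {l : E →L[ℂ] ℂ} (hlu : l u = 1) (hlv : l v = 0)
    (hf : ContDiff ℂ ω f) (hfu : ∀ z (s : ℂ), f (z + s • u) = f z)
    (hfj : ∀ i, f =O[𝓝 (a i)] fun z => ‖z - a i‖ ^ (N + 1))
    (hg : ContDiff ℂ ω g) (hgv : ∀ z (s : ℂ), g (z + s • v) = g z)
    (hgj : ∀ i, g =O[𝓝 (a i)] fun z => ‖z - a i‖ ^ (N + 1)) :
    Approximable (jetAut a N) fun z => (f z * g z) • v := by
  have h1 : IsCompleteField (jetAut a N) fun z => (g z * l z) • v := by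
    refine isCompleteField_shear (f := fun z => g z * l z) (by fun_prop) (by simp [hgv, hlv])
      fun i => ?_
    have : (fun z => l z) =O[𝓝 (a i)] fun _ => (1 : ℝ) := (l.continuous.tendsto (a i)).isBigO_one ℝ
    simpa using (hgj i).mul this
  have h2 : IsCompleteField (jetAut a N) fun z => (f z * l z) • u :=
    isCompleteField_overshear hf l.contDiff hfu (by simp [hlu]) hfj
  have h3 := (approximable_bracket hf hfu hfj h1).add (approximable_bracket hg hgv hgj h2)
  have key : ∀ (h : E → ℂ) (w : E), ContDiff ℂ ω h → ∀ z x,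
      fderiv ℂ (fun z => (h z * l z) • w) z x = (h z * l x + l z * fderiv ℂ h z x) • w := by
    intro h w hh z x
    have := (((hh.differentiable (by simp) z).hasFDerivAt.fun_mul (l.hasFDerivAt (x := z))).smul_const
      w).fderiv
    rw [this]
    simp
  convert h3 using 2 with z
  rw [key g v hg, key f u hf]
  simp only [map_smul, smul_eq_mul, hlu, hlv]
  module

end Brackets

section PolynomialFields

open Topology
open scoped ContDiff

variable {n : ℕ} {ι : Type*}

/-- Polynomial functions on `ℂⁿ`. -/
def IsPolyFun (f : EuclideanSpace ℂ (Fin n) → ℂ) : Prop :=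
  ∃ p : MvPolynomial (Fin n) ℂ, ∀ z, f z = MvPolynomial.eval (fun i => z i) p

namespace IsPolyFun

variable {f g : EuclideanSpace ℂ (Fin n) → ℂ}

lemma const (c : ℂ) : IsPolyFun fun _ : EuclideanSpace ℂ (Fin n) => c :=
  ⟨MvPolynomial.C c, by simp⟩

lemma add (hf : IsPolyFun f) (hg : IsPolyFun g) : IsPolyFun fun z => f z + g z := by
  obtain ⟨p, hp⟩ := hf
  obtain ⟨q, hq⟩ := hg
  exact ⟨p + q, by simp [hp, hq]⟩

lemma mul (hf : IsPolyFun f) (hg : IsPolyFun g) : IsPolyFun fun z => f z * g z := by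
  obtain ⟨p, hp⟩ := hf
  obtain ⟨q, hq⟩ := hg
  exact ⟨p * q, by simp [hp, hq]⟩

lemma pow (hf : IsPolyFun f) (k : ℕ) : IsPolyFun fun z => f z ^ k := by
  obtain ⟨p, hp⟩ := hf
  exact ⟨p ^ k, by simp [hp]⟩

lemma prod {κ : Type*} (s : Finset κ) {f : κ → EuclideanSpace ℂ (Fin n) → ℂ}
    (hf : ∀ i, IsPolyFun (f i)) : IsPolyFun fun z => ∏ i ∈ s, f i z := by
  choose p hp using hf
  exact ⟨∏ i ∈ s, p i, by simp [hp, map_prod]⟩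

lemma clm (l : EuclideanSpace ℂ (Fin n) →L[ℂ] ℂ) : IsPolyFun l := by
  refine ⟨∑ i, MvPolynomial.C (l (EuclideanSpace.single i 1)) * MvPolynomial.X i, fun z => ?_⟩
  conv_lhs => rw [← (EuclideanSpace.basisFun (Fin n) ℂ).sum_repr z]
  simp [map_sum, mul_comm]

lemma contDiff (hf : IsPolyFun f) : ContDiff ℂ ω f := by
  obtain ⟨p, hp⟩ := hf
  obtain rfl : f = _ := funext hp
  clear hp
  induction p using MvPolynomial.induction_on with
  | C c => simpa using contDiff_const
  | add p q hp' hq' =>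
    simp only [map_add]
    exact hp'.add hq'
  | mul_X p i hp' =>
    simp only [map_mul, MvPolynomial.eval_X]
    exact hp'.mul (by fun_prop)

end IsPolyFun

lemma isBigO_mul_contDiff {E : Type*} [NormedAddCommGroup E] [NormedSpace ℂ E] {f g : E → ℂ}
    {b : E} {k : ℕ} (hf : f =O[𝓝 b] fun z => ‖z - b‖ ^ k) (hg : ContDiff ℂ ω g) :
    (fun z => g z * f z) =O[𝓝 b] fun z => ‖z - b‖ ^ k := by
  have : g =O[𝓝 b] fun _ => (1 : ℝ) := (hg.continuous.tendsto b).isBigO_one ℝ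
  simpa using this.mul hf

lemma approximable_poly_mul_smul {a : ι → EuclideanSpace ℂ (Fin n)} {N : ℕ}
    {u v : EuclideanSpace ℂ (Fin n)} {l m : EuclideanSpace ℂ (Fin n) →L[ℂ] ℂ}
    (hlu : l u = 1) (hlv : l v = 0) (hmu : m u = 0)
    {q : EuclideanSpace ℂ (Fin n) → ℂ} (hq : IsPolyFun q)
    {f g : EuclideanSpace ℂ (Fin n) → ℂ}
    (hf : ContDiff ℂ ω f) (hfu : ∀ z (s : ℂ), f (z + s • u) = f z)
    (hfj : ∀ i, f =O[𝓝 (a i)] fun z => ‖z - a i‖ ^ (N + 1))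
    (hg : ContDiff ℂ ω g) (hgv : ∀ z (s : ℂ), g (z + s • v) = g z)
    (hgj : ∀ i, g =O[𝓝 (a i)] fun z => ‖z - a i‖ ^ (N + 1)) :
    Approximable (jetAut a N) fun z => (q z * (f z * g z)) • v := by
  obtain ⟨p, hp⟩ := hq
  simp only [hp]
  clear hp
  induction p using MvPolynomial.induction_on generalizing f g with
  | C c =>
    simp only [MvPolynomial.eval_C, ← mul_assoc]
    exact approximable_mul_smul hlu hlv (contDiff_const.mul hf) (by simp [hfu])
      (fun i => isBigO_mul_contDiff (hfj i) contDiff_const) hg hgv hgj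
  | add p q hp' hq' =>
    simp only [map_add, add_mul, add_smul]
    exact (hp' hf hfu hfj hg hgv hgj).add (hq' hf hfu hfj hg hgv hgj)
  | mul_X p i hp' =>
    simp only [map_mul, MvPolynomial.eval_X]
    let k : EuclideanSpace ℂ (Fin n) →L[ℂ] ℂ := EuclideanSpace.proj i - u i • l - v i • m
    have hk : ∀ z : EuclideanSpace ℂ (Fin n), k z = z i - u i * l z - v i * m z := fun z => by
      simp [k]
    have hku : k u = 0 := by rw [hk, hlu, hmu]; ring
    have h1 := hp' (f := fun z => (k z + v i * m z) * f z) (g := g) (by fun_prop)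
      (by simp [hfu, hku, hmu])
      (fun j => isBigO_mul_contDiff (g := fun z => k z + v i * m z) (hfj j) (by fun_prop)) hg hgv hgj
    have h2 := hp' (f := f) (g := fun z => (u i * l z) * g z) hf hfu hfj (by fun_prop)
      (by simp [hgv, hlv])
      (fun j => isBigO_mul_contDiff (g := fun z => u i * l z) (hgj j) (by fun_prop))
    convert h1.add h2 using 2 with z
    rw [hk]
    module

lemma exists_generic_basis {κ : Type*} [Finite κ] (w : κ → EuclideanSpace ℂ (Fin n))
    (hw : ∀ j, w j ≠ 0) :
    ∃ (l : Fin n → EuclideanSpace ℂ (Fin n) →L[ℂ] ℂ) (v : Fin n → EuclideanSpace ℂ (Fin n)),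
      (∀ i j, l i (v j) = if i = j then 1 else 0) ∧ (∀ i j, l i (w j) ≠ 0) ∧
      ∀ z, z = ∑ i, l i z • v i := by
  classical
  let Q : κ → Polynomial ℂ := fun j => ∑ i : Fin n, Polynomial.C (w j i) * Polynomial.X ^ (i : ℕ)
  have hQ : ∀ j, Q j ≠ 0 := by
    intro j h0
    apply hw j
    ext i
    have := congrArg (fun q => q.coeff i) h0
    simpa [Q, Polynomial.finsetSum_coeff, Polynomial.coeff_X_pow, Fin.val_inj] using this
  have hfin : (⋃ j, {c | (Q j).IsRoot c}).Finite :=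
    Set.finite_iUnion fun j => Polynomial.finite_setOfPred_isRoot (hQ j)
  have hinf : (⋃ j, {c | (Q j).IsRoot c})ᶜ.Infinite := hfin.infinite_compl
  let c : Fin n → ℂ := fun i => hinf.natEmbedding _ i
  have hc : Function.Injective c := fun i j h =>
    Fin.ext ((hinf.natEmbedding _).injective (Subtype.ext h))
  have hcQ : ∀ i j, (Q j).eval (c i) ≠ 0 := fun i j h =>
    (hinf.natEmbedding _ i).2 (Set.mem_iUnion.mpr ⟨j, h⟩)
  let V := Matrix.vandermonde c
  have hdet : IsUnit V.det := isUnit_iff_ne_zero.mpr (Matrix.det_vandermonde_ne_zero_iff.mpr hc)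
  let l : Fin n → EuclideanSpace ℂ (Fin n) →L[ℂ] ℂ := fun i =>
    ∑ k, V i k • EuclideanSpace.proj k
  have hl : ∀ i z, l i z = ∑ k, V i k * z k := fun i z => by simp [l]
  refine ⟨l, fun j => WithLp.toLp 2 fun k => V⁻¹ k j, fun i j => ?_, fun i j => ?_, fun z => ?_⟩
  · have := congrFun (congrFun (Matrix.mul_nonsing_inv V hdet) i) j
    rw [Matrix.mul_apply, Matrix.one_apply] at this
    rw [hl]
    exact this
  · have := hcQ i j
    rw [hl]
    convert this using 1
    simp only [Q, Polynomial.eval_finsetSum, Polynomial.eval_mul, Polynomial.eval_C,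
      Polynomial.eval_pow, Polynomial.eval_X, V, Matrix.vandermonde_apply]
    exact Finset.sum_congr rfl fun k _ => mul_comm _ _
  · ext k
    have h1 : V⁻¹.mulVec (V.mulVec z) = z := by
      rw [Matrix.mulVec_mulVec, Matrix.nonsing_inv_mul V hdet, Matrix.one_mulVec]
    have h2 := congrFun h1 k
    simp only [Matrix.mulVec, dotProduct] at h2
    simp only [WithLp.ofLp_sum, WithLp.ofLp_smul, Finset.sum_apply, Pi.smul_apply, smul_eq_mul, hl]
    rw [← h2]
    exact Finset.sum_congr rfl fun i _ => mul_comm _ _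

lemma norm_smoothstep_le {w : ℂ} (hw : ‖w‖ ≤ 1 / 10) : ‖w ^ 2 * (3 - 2 * w)‖ ≤ ‖w‖ / 2 := by
  have h1 : ‖3 - 2 * w‖ ≤ 3 + 2 * ‖w‖ := by
    refine (norm_sub_le _ _).trans ?_
    simp
  rw [norm_mul, norm_pow]
  have h0 := norm_nonneg w
  calc ‖w‖ ^ 2 * ‖3 - 2 * w‖ ≤ ‖w‖ ^ 2 * (3 + 2 * ‖w‖) := by gcongr
    _ ≤ ‖w‖ / 2 := by nlinarith [mul_nonneg h0 h0]

lemma norm_iterate_smoothstep_le {w : ℂ} (hw : ‖w‖ ≤ 1 / 10) (k : ℕ) :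
    ‖(fun w : ℂ => w ^ 2 * (3 - 2 * w))^[k] w‖ ≤ 1 / 10 * (1 / 2) ^ k := by
  induction k with
  | zero => simpa using hw
  | succ k ih =>
    rw [Function.iterate_succ_apply']
    refine (norm_smoothstep_le (ih.trans ?_)).trans ?_
    · have : (1 / 2 : ℝ) ^ k ≤ 1 := pow_le_one₀ (by norm_num) (by norm_num)
      linarith
    · rw [pow_succ]
      linarith

lemma norm_one_sub_iterate_smoothstep_le {w : ℂ} (hw : ‖1 - w‖ ≤ 1 / 10) (k : ℕ) :
    ‖1 - (fun w : ℂ => w ^ 2 * (3 - 2 * w))^[k] w‖ ≤ 1 / 10 * (1 / 2) ^ k := by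
  have : 1 - (fun w : ℂ => w ^ 2 * (3 - 2 * w))^[k] w
      = (fun w : ℂ => w ^ 2 * (3 - 2 * w))^[k] (1 - w) := by
    induction k with
    | zero => rfl
    | succ k ih =>
      rw [Function.iterate_succ_apply', Function.iterate_succ_apply', ← ih]
      ring
  rw [this]
  exact norm_iterate_smoothstep_le hw k

/-- A point outside a polynomially convex set is separated from it by a polynomial. -/
lemma IsPolynomiallyConvex.exists_polyFun {K : Set (EuclideanSpace ℂ (Fin n))}
    (hK : IsPolynomiallyConvex K) {x : EuclideanSpace ℂ (Fin n)} (hx : x ∉ K) :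
    ∃ f, IsPolyFun f ∧ f x = 1 ∧ ∃ θ, 0 ≤ θ ∧ θ < 1 ∧ ∀ z ∈ K, ‖f z‖ ≤ θ := by
  rcases K.eq_empty_or_nonempty with rfl | ⟨y, hy⟩
  · exact ⟨fun _ => 1, .const 1, rfl, 0, le_rfl, one_pos, by simp⟩
  rw [← hK] at hx
  simp only [polyHull, Set.mem_ofPred_eq, not_forall, not_le] at hx
  obtain ⟨p, c, hp, hc⟩ := hx
  have hc0 : 0 ≤ c := (norm_nonneg _).trans (hp y hy)
  have hpos := hc0.trans_lt hc
  refine ⟨fun z => (MvPolynomial.eval (fun i => x i) p)⁻¹ * MvPolynomial.eval (fun i => z i) p,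
    (IsPolyFun.const _).mul ⟨p, fun _ => rfl⟩, inv_mul_cancel₀ (norm_pos_iff.mp hpos),
    c / ‖MvPolynomial.eval (fun i => x i) p‖, by positivity, (div_lt_one hpos).mpr hc,
    fun z hz => ?_⟩
  rw [norm_mul, norm_inv, inv_mul_eq_div]
  gcongr
  exact hp z hz

/-- Vector fields that are close to a given constant near a point outside a polynomially convex
set, and close to zero near the set. -/
lemma IsPolynomiallyConvex.exists_approximable (hn : 2 ≤ n) [Fintype ι]
    {K : Set (EuclideanSpace ℂ (Fin n))} (hKc : IsCompact K)
    (hK : IsPolynomiallyConvex K) (a : ι → EuclideanSpace ℂ (Fin n)) (ha : ∀ j, a j ∈ K) (N : ℕ)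
    {x : EuclideanSpace ℂ (Fin n)} (hx : x ∉ K) :
    ∃ U, IsOpen U ∧ K ⊆ U ∧ ∃ ρ > 0, ∀ V : EuclideanSpace ℂ (Fin n), ∀ η > 0, ∃ X,
      Approximable (jetAut a N) X ∧ (∀ z ∈ U, ‖X z‖ ≤ η) ∧
      ∀ z ∈ Metric.ball x ρ, ‖X z - V‖ ≤ η := by
  obtain ⟨f, hf, hfx, θ, hθ0, hθ1, hfK⟩ := hK.exists_polyFun hx
  obtain ⟨l, v, hlv, hlw, hsum⟩ := exists_generic_basis (fun j => x - a j) fun j h =>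
    hx (by rw [sub_eq_zero] at h; exact h ▸ ha j)
  let A : Fin n → EuclideanSpace ℂ (Fin n) → ℂ := fun i z => ∏ j, (l i (z - a j)) ^ (N + 1)
  have hA : ∀ i, IsPolyFun (A i) := fun i => IsPolyFun.prod _ fun j => by
    have : IsPolyFun fun z => l i z + (-l i (a j)) := (IsPolyFun.clm (l i)).add (.const _)
    simpa [sub_eq_add_neg] using this.pow (N + 1)
  have hAx : ∀ i, A i x ≠ 0 := fun i => Finset.prod_ne_zero_iff.mpr fun j _ =>
    pow_ne_zero _ (hlw i j)
  have hAinv : ∀ i k, i ≠ k → ∀ z (s : ℂ), A i (z + s • v k) = A i z := by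
    intro i k hik z s
    simp [A, hlv, hik]
  have hAjet : ∀ i j, A i =O[𝓝 (a j)] fun z => ‖z - a j‖ ^ (N + 1) := by
    intro i j
    classical
    have h1 : (fun z => l i (z - a j) ^ (N + 1)) =O[𝓝 (a j)] fun z => ‖z - a j‖ ^ (N + 1) :=
      (((l i).isBigO_comp (fun z => z - a j) _).norm_right).pow _
    have h2 : ContDiff ℂ ω fun z => ∏ k ∈ Finset.univ.erase j, (l i (z - a k)) ^ (N + 1) := by
      fun_prop
    refine (isBigO_mul_contDiff h1 h2).congr_left fun z => ?_
    exact Finset.prod_erase_mul _ _ (Finset.mem_univ j)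
  have hother : ∀ i : Fin n, ∃ k, k ≠ i := fun i => by
    have : Nontrivial (Fin n) := Fin.nontrivial_iff_two_le.mpr hn
    exact exists_ne i
  choose o ho using hother
  obtain ⟨M, hM⟩ : ∃ M : ℕ, ∀ i, ∀ z ∈ K,
      ‖f z ^ M * (A i x * A (o i) x)⁻¹ * (A i z * A (o i) z)‖ < 1 / 10 := by
    have hb : ∀ i, ∃ C, ∀ z ∈ K, ‖(A i x * A (o i) x)⁻¹ * (A i z * A (o i) z)‖ ≤ C := fun i =>
      hKc.exists_bound_of_continuousOn
        (continuous_const.mul ((hA i).contDiff.continuous.mul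
          (hA (o i)).contDiff.continuous)).continuousOn
    choose C hC using hb
    have hlim : ∀ i, ∀ᶠ M : ℕ in atTop, θ ^ M * C i < 1 / 10 := fun i => by
      have := (tendsto_pow_atTop_nhds_zero_of_lt_one hθ0 hθ1).mul_const (C i)
      rw [zero_mul] at this
      exact this.eventually (gt_mem_nhds (by norm_num))
    obtain ⟨M, hM⟩ := (eventually_all.mpr hlim).exists
    refine ⟨M, fun i z hz => lt_of_le_of_lt ?_ (hM i)⟩
    rw [mul_assoc, norm_mul, norm_pow]
    gcongr
    · exact hfK z hz
    · exact hC i z hz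
  let F : Fin n → EuclideanSpace ℂ (Fin n) → ℂ := fun i z =>
    f z ^ M * (A i x * A (o i) x)⁻¹ * (A i z * A (o i) z)
  have hF : ∀ i, Continuous (F i) := fun i =>
    (((hf.pow M).mul (.const _)).mul ((hA i).mul (hA (o i)))).contDiff.continuous
  have hFx : ∀ i, F i x = 1 := fun i => by
    have := hAx i
    have := hAx (o i)
    simp only [F, hfx]
    field_simp
    simp
  obtain ⟨ρ, hρ, hρF⟩ : ∃ ρ > 0, ∀ z ∈ Metric.ball x ρ, ∀ i, ‖1 - F i z‖ < 1 / 10 := by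
    refine Metric.eventually_nhds_iff_ball.mp (eventually_all.mpr fun i => ?_)
    have : Tendsto (fun z => ‖1 - F i z‖) (𝓝 x) (𝓝 0) := by
      have hc : Continuous fun z => ‖1 - F i z‖ := (continuous_const.sub (hF i)).norm
      simpa [hFx] using hc.tendsto x
    exact this.eventually (gt_mem_nhds (by norm_num))
  have hiter : ∀ i k, ∃ q, IsPolyFun q ∧ ∀ z,
      (fun w : ℂ => w ^ 2 * (3 - 2 * w))^[k] (F i z) = q z * (A i z * A (o i) z) := by
    intro i k
    induction k with
    | zero => exact ⟨_, (hf.pow M).mul (.const _), fun z => rfl⟩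
    | succ k ih =>
      obtain ⟨q, hq, h⟩ := ih
      have hw := hq.mul ((hA i).mul (hA (o i)))
      refine ⟨_, hq.mul (hw.mul ((IsPolyFun.const 3).add ((IsPolyFun.const (-2)).mul hw))),
        fun z => ?_⟩
      rw [Function.iterate_succ_apply', h]
      ring
  refine ⟨{z | ∀ i, ‖F i z‖ < 1 / 10}, ?_, fun z hz i => hM i z hz, ρ, hρ, fun V η hη => ?_⟩
  · simp only [Set.ofPred_forall]
    exact isOpen_iInter_of_finite fun i => isOpen_lt (hF i).norm continuous_const
  set S : ℝ := ∑ i, ‖l i V‖ * ‖v i‖ with hS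
  have hS0 : 0 ≤ S := by positivity
  obtain ⟨k, hk⟩ : ∃ k : ℕ, S * (1 / 10 * (1 / 2) ^ k) < η := by
    have : Tendsto (fun k : ℕ => S * (1 / 10 * (1 / 2 : ℝ) ^ k)) atTop (𝓝 0) := by
      have := ((tendsto_pow_atTop_nhds_zero_of_lt_one (r := (1 / 2 : ℝ)) (by norm_num)
        (by norm_num)).const_mul (1 / 10)).const_mul S
      simpa using this
    exact (this.eventually (gt_mem_nhds hη)).exists
  choose q hq hqF using fun i => hiter i k
  have hbound : ∀ (c : Fin n → ℂ), (∀ i, ‖c i‖ ≤ 1 / 10 * (1 / 2) ^ k) →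
      ‖∑ i, (l i V * c i) • v i‖ ≤ η := by
    intro c hc
    refine (norm_sum_le _ _).trans (le_trans ?_ hk.le)
    rw [hS, Finset.sum_mul]
    refine Finset.sum_le_sum fun i _ => ?_
    rw [norm_smul, norm_mul, mul_right_comm]
    gcongr
    exact hc i
  refine ⟨fun z => ∑ i, (l i V * (fun w : ℂ => w ^ 2 * (3 - 2 * w))^[k] (F i z)) • v i, ?_,
    fun z hz => hbound _ fun i => norm_iterate_smoothstep_le (hz i).le k, fun z hz => ?_⟩
  · refine Approximable.sum _ fun i _ => ?_
    simp only [hqF, ← mul_assoc]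
    have := approximable_poly_mul_smul (a := a) (N := N) (u := v (o i)) (v := v i) (l := l (o i))
      (m := l i) (by simp [hlv]) (by simp [hlv, ho i]) (by simp [hlv, (ho i).symm])
      ((IsPolyFun.const (l i V)).mul (hq i)) (hA i).contDiff (hAinv i (o i) (ho i).symm)
      (hAjet i) (hA (o i)).contDiff (hAinv (o i) i (ho i)) (hAjet (o i))
    simpa only [← mul_assoc] using this
  · have h1 := hbound (fun i => 1 - (fun w : ℂ => w ^ 2 * (3 - 2 * w))^[k] (F i z)) fun i =>
      norm_one_sub_iterate_smoothstep_le (hρF z hz i).le k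
    rw [norm_sub_rev]
    simp only [mul_one_sub, sub_smul, Finset.sum_sub_distrib, ← hsum V] at h1
    exact h1

end PolynomialFields

section MovingPoints

open Topology
open scoped ContDiff

lemma norm_iterate_sub_le {E : Type*} [NormedAddCommGroup E] [NormedSpace ℝ E]
    {f : E → E} {x V : E} {c : ℝ} {k : ℕ}
    (hf : ∀ j < k, ∀ w, ‖w - (x + (j : ℝ) • V)‖ ≤ j * c → ‖f w - w - V‖ ≤ c) :
    ‖f^[k] x - (x + (k : ℝ) • V)‖ ≤ k * c := by
  suffices ∀ j ≤ k, ‖f^[j] x - (x + (j : ℝ) • V)‖ ≤ j * c from this k le_rfl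
  intro j
  induction j with
  | zero => simp
  | succ j ih =>
    intro hj
    have h1 := ih (by lia)
    have h2 := hf j (by lia) _ h1
    rw [Function.iterate_succ_apply']
    have : f (f^[j] x) - (x + ((j + 1 : ℕ) : ℝ) • V)
        = (f (f^[j] x) - f^[j] x - V) + (f^[j] x - (x + (j : ℝ) • V)) := by
      push_cast
      module
    rw [this]
    refine (norm_add_le _ _).trans ?_
    push_cast
    linarith

/-- The point `x` can be moved arbitrarily close to `y` by elements of `G` that are arbitrarily
close to the identity on a neighbourhood of `K`. -/
def PushesTo {E : Type*} [NormedAddCommGroup E] (G : Subgroup (Equiv.Perm E)) (K : Set E)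
    (x y : E) : Prop :=
  ∃ U, IsOpen U ∧ K ⊆ U ∧ ∀ ε > 0, NearId G U fun σ => ‖σ x - y‖ < ε

lemma PushesTo.trans {E : Type*} [NormedAddCommGroup E] [NormedSpace ℂ E] [ProperSpace E]
    {G : Subgroup (Equiv.Perm E)} {K : Set E} {x y z : E}
    (hG : ∀ σ ∈ G, Continuous σ) (h₁ : PushesTo G K x y) (h₂ : PushesTo G K y z) :
    PushesTo G K x z := by
  obtain ⟨U₁, hU₁, hK₁, h₁⟩ := h₁
  obtain ⟨U₂, hU₂, hK₂, h₂⟩ := h₂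
  refine ⟨U₁ ∩ U₂, hU₁.inter hU₂, Set.subset_inter hK₁ hK₂, fun ε hε => ?_⟩
  have hsub : ∀ {T : Equiv.Perm E → Prop} {U V : Set E}, V ⊆ U → NearId G U T → NearId G V T :=
    fun hUV h L hL => h L (hL.trans hUV)
  have key : NearId G (U₁ ∩ U₂) fun σ => ‖σ⁻¹ x - z‖ < ε := by
    refine NearId.mul (hU₁.inter hU₂)
      (T₁ := fun σ => ∃ δ > 0, ∀ w, ‖w - y‖ < δ → ‖σ⁻¹ w - z‖ < ε)
      (T₂ := fun σ τ => ‖σ⁻¹ (τ⁻¹ x) - z‖ < ε) ?_ ?_ fun σ _ τ _ _ h => by simpa using h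
    · refine (hsub Set.inter_subset_right (h₂ ε hε).inv).mono fun σ hσ h => ?_
      have hc : Continuous fun w => ‖σ⁻¹ w - z‖ := ((hG _ (G.inv_mem hσ)).sub continuous_const).norm
      obtain ⟨δ, hδ, h'⟩ := Metric.eventually_nhds_iff_ball.mp
        ((hc.tendsto y).eventually (gt_mem_nhds h))
      exact ⟨δ, hδ, fun w hw => h' w (by simpa [dist_eq_norm] using hw)⟩
    · rintro σ - ⟨δ, hδ, h⟩
      exact (hsub Set.inter_subset_left (h₁ δ hδ).inv).mono fun τ _ hτ => h _ hτ
  simpa using key.inv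

variable {n : ℕ} {ι : Type*}

lemma IsPolynomiallyConvex.exists_ball_pushesTo (hn : 2 ≤ n) [Fintype ι]
    {K : Set (EuclideanSpace ℂ (Fin n))} (hKc : IsCompact K)
    (hK : IsPolynomiallyConvex K) (a : ι → EuclideanSpace ℂ (Fin n)) (ha : ∀ j, a j ∈ K) (N : ℕ)
    {p : EuclideanSpace ℂ (Fin n)} (hp : p ∉ K) :
    ∃ r > 0, ∀ x ∈ Metric.ball p r, ∀ y ∈ Metric.ball p r, PushesTo (jetAut a N) K x y := by
  obtain ⟨U, hU, hKU, ρ, hρ, hX⟩ := hK.exists_approximable hn hKc a ha N hp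
  refine ⟨ρ / 2, by positivity, fun x hx y hy => ⟨U, hU, hKU, fun ε hε L hLU hL ε' hε' => ?_⟩⟩
  obtain ⟨δ, hδ, hδU⟩ := hL.exists_cthickening_subset_open hU hLU
  set η := min (ρ / 4) (min (δ / 2) (min (ε / 4) (ε' / 4))) with hη
  have hη0 : 0 < η := by positivity
  have hηρ : η ≤ ρ / 4 := min_le_left _ _
  have hηδ : η ≤ δ / 2 := (min_le_right _ _).trans (min_le_left _ _)
  have hηε : η ≤ ε / 4 := (min_le_right _ _).trans ((min_le_right _ _).trans (min_le_left _ _))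
  have hηε' : η ≤ ε' / 4 :=
    (min_le_right _ _).trans ((min_le_right _ _).trans (min_le_right _ _))
  obtain ⟨X, ⟨-, hXa⟩, hXU, hXp⟩ := hX (y - x) η hη0
  have hev := hXa (Metric.closedBall p ρ ∪ Metric.cthickening δ L)
    ((isCompact_closedBall p ρ).union hL.cthickening) η hη0
  have hlim : Tendsto (fun k : ℕ => 1 / ((k : ℝ) + 1)) atTop (𝓝[>] 0) :=
    tendsto_nhdsWithin_of_tendsto_nhds_of_eventually_within _
      tendsto_one_div_add_atTop_nhds_zero_nat (.of_forall fun k => by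
        simp only [Set.mem_Ioi]; positivity)
  obtain ⟨k, σ, hσ, hσX⟩ := (hlim.eventually hev).exists
  set t := 1 / ((k : ℝ) + 1) with ht
  have ht0 : 0 < t := by positivity
  have hkt : ((k + 1 : ℕ) : ℝ) * t = 1 := by rw [ht]; push_cast; field_simp
  have hjt : ∀ j < k + 1, (j : ℝ) * t ≤ 1 := fun j hj => by
    rw [← hkt]
    gcongr
  have hcs : ∀ (c : ℝ) (v : EuclideanSpace ℂ (Fin n)), ‖((c : ℝ) : ℂ) • v‖ = |c| * ‖v‖ :=
    fun c v => by simp [norm_smul]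
  have hsmall : ∀ f : EuclideanSpace ℂ (Fin n) → EuclideanSpace ℂ (Fin n),
      (∀ w ∈ Metric.cthickening δ L, ‖f w - w‖ ≤ 2 * η * t) → ∀ z ∈ L,
        ‖f^[k + 1] z - z‖ < ε' := by
    intro f hf z hz
    have := norm_iterate_sub_le (f := f) (x := z) (V := 0) (c := 2 * η * t) (k := k + 1)
      fun j hj w hw => by
        rw [sub_zero]
        refine hf w (Metric.mem_cthickening_of_dist_le w z δ L hz ?_)
        rw [smul_zero, add_zero] at hw
        rw [dist_eq_norm]
        nlinarith [hjt j hj]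
    rw [smul_zero, add_zero] at this
    refine this.trans_lt ?_
    nlinarith
  refine ⟨σ ^ (k + 1), pow_mem hσ _, ?_, fun z hz => ⟨?_, ?_⟩⟩
  · change ‖(σ ^ (k + 1)) x - y‖ < ε
    rw [← Equiv.Perm.iterate_eq_pow]
    have := norm_iterate_sub_le (f := σ) (x := x) (V := t • (y - x)) (c := 2 * η * t) (k := k + 1)
      fun j hj w hw => by
        have hj0 : 0 ≤ (j : ℝ) * t := by positivity
        have hseg : x + (j : ℝ) • t • (y - x) ∈ Metric.ball p (ρ / 2) := by
          rw [smul_smul]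
          exact (convex_ball p (ρ / 2)).add_smul_sub_mem hx hy ⟨hj0, hjt j hj⟩
        have hwp : w ∈ Metric.ball p ρ := by
          rw [Metric.mem_ball] at hseg ⊢
          refine (dist_triangle w (x + (j : ℝ) • t • (y - x)) p).trans_lt ?_
          rw [dist_eq_norm w]
          nlinarith [hjt j hj]
        have h1 := (hσX w (Or.inl (Metric.ball_subset_closedBall hwp))).1
        have h2 := hXp w hwp
        have h3 : σ w - w - t • (y - x) = (σ w - w - (t : ℂ) • X w)
            + (t : ℂ) • (X w - (y - x)) := by
          rw [smul_sub (t : ℂ), Complex.coe_smul t (y - x)]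
          abel
        rw [h3]
        refine (norm_add_le _ _).trans ?_
        rw [hcs, abs_of_pos ht0]
        nlinarith
    have h4 : x + ((k + 1 : ℕ) : ℝ) • t • (y - x) = y := by
      rw [smul_smul, hkt, one_smul]
      abel
    rw [h4] at this
    refine this.trans_lt ?_
    nlinarith
  · rw [← Equiv.Perm.iterate_eq_pow]
    refine hsmall _ (fun w hw => ?_) z hz
    have h1 := (hσX w (Or.inr hw)).1
    have h2 := hXU w (hδU hw)
    have h3 : σ w - w = (σ w - w - (t : ℂ) • X w) + (t : ℂ) • X w := by abel
    rw [h3]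
    refine (norm_add_le _ _).trans ?_
    rw [hcs, abs_of_pos ht0]
    nlinarith
  · rw [← inv_pow, ← Equiv.Perm.iterate_eq_pow]
    refine hsmall _ (fun w hw => ?_) z hz
    have h1 := (hσX w (Or.inr hw)).2
    have h2 := hXU w (hδU hw)
    have h3 : σ⁻¹ w - w = (σ⁻¹ w - w + (t : ℂ) • X w) - (t : ℂ) • X w := by abel
    rw [h3]
    refine (norm_sub_le _ _).trans ?_
    rw [hcs, abs_of_pos ht0]
    nlinarith

lemma IsPolynomiallyConvex.exists_pushesTo_far (hn : 2 ≤ n) [Fintype ι]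
    {K : Set (EuclideanSpace ℂ (Fin n))} (hKc : IsCompact K)
    (hK : IsPolynomiallyConvex K) (a : ι → EuclideanSpace ℂ (Fin n)) (ha : ∀ j, a j ∈ K) (N : ℕ)
    {p : EuclideanSpace ℂ (Fin n)} (hp : p ∉ K) {R : ℝ} (hR : 0 ≤ R) (hKR : ∀ z ∈ K, ‖z‖ ≤ R)
    {c : EuclideanSpace ℂ (Fin n)} (hc : R < ‖c‖) : PushesTo (jetAut a N) K p c := by
  let Q : EuclideanSpace ℂ (Fin n) → EuclideanSpace ℂ (Fin n) → Prop := fun x y =>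
    PushesTo (jetAut a N) K x y ∧ PushesTo (jetAut a N) K y x
  have hcont : ∀ σ ∈ jetAut a N, Continuous σ := fun σ hσ => (jetAut.contDiff hσ).continuous
  have hQ : ∀ {x y z}, Q x y → Q y z → Q x z := fun h₁ h₂ =>
    ⟨h₁.1.trans hcont h₂.1, h₂.2.trans hcont h₁.2⟩
  have hloc : ∀ x ∉ K, ∃ r > 0, ∀ y ∈ Metric.ball x r, y ∉ K ∧ Q x y := by
    intro x hx
    obtain ⟨r, hr, h⟩ := hK.exists_ball_pushesTo hn hKc a ha N hx
    obtain ⟨r', hr', h'⟩ := Metric.isOpen_iff.mp hKc.isClosed.isOpen_compl x hx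
    have hxr := Metric.mem_ball_self (x := x) hr
    exact ⟨min r r', by positivity, fun y hy => ⟨h' (Metric.ball_subset_ball (min_le_right _ _) hy),
      have hy' := Metric.ball_subset_ball (min_le_left _ _) hy
      ⟨h x hxr y hy', h y hy' x hxr⟩⟩⟩
  let S : Set (EuclideanSpace ℂ (Fin n)) := {y | y ∉ K ∧ Q p y}
  have hSo : IsOpen S := by
    rw [Metric.isOpen_iff]
    rintro y ⟨hy, hpy⟩
    obtain ⟨r, hr, h⟩ := hloc y hy
    exact ⟨r, hr, fun z hz => ⟨(h z hz).1, hQ hpy (h z hz).2⟩⟩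
  have hSf : frontier S ⊆ K := by
    intro z hz
    by_contra hzK
    obtain ⟨r, hr, h⟩ := hloc z hzK
    obtain ⟨y, hy, hzy⟩ := Metric.mem_closure_iff.mp (frontier_subset_closure hz) r hr
    have hzS : z ∈ S := ⟨hzK, hQ hy.2 ((h y (by rwa [Metric.mem_ball, dist_comm])).2).symm⟩
    rw [IsOpen.frontier_eq hSo] at hz
    exact hz.2 hzS
  have hpS : p ∈ S := by
    obtain ⟨r, hr, h⟩ := hloc p hp
    exact h p (Metric.mem_ball_self hr)
  have hSu : ¬ Bornology.IsBounded S := by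
    intro hb
    refine hp ?_
    rw [← hK]
    intro q c hq
    have hd : Differentiable ℂ fun z : EuclideanSpace ℂ (Fin n) =>
        MvPolynomial.eval (fun i => z i) q :=
      (IsPolyFun.contDiff ⟨q, fun _ => rfl⟩).differentiable (by simp)
    have : Nonempty (Fin n) := ⟨⟨0, by lia⟩⟩
    exact Complex.norm_le_of_forall_mem_frontier_norm_le hb hd.diffContOnCl
      (fun z hz => hq z (hSf hz)) (subset_closure hpS)
  obtain ⟨x, hxS, hx⟩ : ∃ x ∈ S, R < ‖x‖ := by
    by_contra! h
    exact hSu (isBounded_iff_forall_norm_le.mpr ⟨R, h⟩)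
  have hconn : IsPreconnected {z : EuclideanSpace ℂ (Fin n) | R < ‖z‖} := by
    have hrank : 1 < Module.rank ℝ (EuclideanSpace ℂ (Fin n)) := by
      rw [rank_real_of_complex, ← Module.finrank_eq_rank, finrank_euclideanSpace_fin]
      norm_cast
      lia
    have h1 := ((isPreconnected_sphere hrank 0 1).prod (isPreconnected_Ioi (a := R))).image
      (fun v => v.2 • v.1) (by fun_prop)
    convert h1 using 1
    ext z
    simp only [Set.mem_ofPred_eq, Set.mem_image, Set.mem_prod, mem_sphere_zero_iff_norm,
      Set.mem_Ioi, Prod.exists]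
    constructor
    · intro hz
      have hz0 : ‖z‖ ≠ 0 := (hR.trans_lt hz).ne'
      exact ⟨‖z‖⁻¹ • z, ‖z‖, ⟨by rw [norm_smul, norm_inv, norm_norm, inv_mul_cancel₀ hz0], hz⟩,
        smul_inv_smul₀ hz0 z⟩
    · rintro ⟨v, t, ⟨hv, ht⟩, rfl⟩
      rwa [norm_smul, hv, mul_one, Real.norm_of_nonneg (hR.trans ht.le)]
  have hxc : Q x c := by
    refine hconn.induction₂' Q (fun y hy => ?_) (fun _ _ _ _ _ _ h₁ h₂ => hQ h₁ h₂) hx hc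
    obtain ⟨r, hr, h⟩ := hloc y fun hyK => (hKR y hyK).not_gt hy
    filter_upwards [mem_nhdsWithin_of_mem_nhds (Metric.ball_mem_nhds y hr)] with w hw
    exact ⟨(h w hw).2, ((h w hw).2).symm⟩
  exact (hQ hxS.2 hxc).1

end MovingPoints

section CoordinateShears

open Topology
open scoped ContDiff

variable {n : ℕ} {ι : Type*}

/-- Entire functions that are small on a disc, vanish to high order at finitely many points of the
disc, and have a prescribed leading term at a point outside of the disc. -/
lemma exists_entire_leading_term [Fintype ι] {R r ε : ℝ} (hR : 0 < R) (hr : 0 ≤ r) (hrR : r < R)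
    (hε : 0 < ε) {b : ℂ} (hb : R ≤ ‖b‖) (α : ι → ℂ) (hα : ∀ j, ‖α j‖ < R) (N k : ℕ) (c : ℂ) :
    ∃ h : ℂ → ℂ, ContDiff ℂ ω h ∧ (∀ w, ‖w‖ ≤ r → ‖h w‖ < ε) ∧
      ((fun w => h w - c * (w - b) ^ k) =o[𝓝 b] fun w => (w - b) ^ k) ∧
      ∀ j, h =O[𝓝 (α j)] fun w => ‖w - α j‖ ^ (N + 1) := by
  have hb0 : b ≠ 0 := norm_pos_iff.mp (hR.trans_le hb)
  have hbα : ∀ j, b - α j ≠ 0 := fun j h => by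
    rw [sub_eq_zero] at h
    exact (hα j).not_ge (h ▸ hb)
  let A : ℂ → ℂ := fun w => ∏ j, ((w - α j) / (b - α j)) ^ (N + 1)
  have hA : ContDiff ℂ ω A := by
    simp only [A, div_eq_mul_inv]
    fun_prop
  have hAb : A b = 1 := Finset.prod_eq_one fun j _ => by rw [div_self (hbα j), one_pow]
  have hcd : ∀ M : ℕ, ContDiff ℂ ω fun w => c * (w - b) ^ k * (A w * (w / b) ^ M) := fun M => by
    simp only [div_eq_mul_inv]
    fun_prop
  obtain ⟨M, hM⟩ : ∃ M : ℕ, ∀ w, ‖w‖ ≤ r → ‖c * (w - b) ^ k * (A w * (w / b) ^ M)‖ < ε := by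
    obtain ⟨C, hC⟩ := (isCompact_closedBall (0 : ℂ) r).exists_bound_of_continuousOn
      (f := fun w => c * (w - b) ^ k * A w) (by fun_prop)
    have hlim : Tendsto (fun M : ℕ => C * (r / ‖b‖) ^ M) atTop (𝓝 0) := by
      simpa using (tendsto_pow_atTop_nhds_zero_of_lt_one (by positivity)
        ((div_lt_one (hR.trans_le hb)).mpr (hrR.trans_le hb))).const_mul C
    obtain ⟨M, hM⟩ := (hlim.eventually (gt_mem_nhds hε)).exists
    refine ⟨M, fun w hw => lt_of_le_of_lt ?_ hM⟩
    rw [← mul_assoc, norm_mul, norm_pow, norm_div]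
    gcongr
    · exact (norm_nonneg _).trans (hC w (by simpa using hw))
    · exact hC w (by simpa using hw)
  refine ⟨_, hcd M, hM, ?_, fun j => ?_⟩
  · have h1 : Tendsto (fun w => c * (A w * (w / b) ^ M - 1)) (𝓝 b) (𝓝 0) := by
      have : Continuous fun w => c * (A w * (w / b) ^ M - 1) := by
        simp only [div_eq_mul_inv]
        fun_prop
      simpa [hAb, div_self hb0] using this.tendsto b
    have h2 := ((isLittleO_one_iff ℂ).mpr h1).mul_isBigO
      (isBigO_refl (fun w => (w - b) ^ k) (𝓝 b))
    refine (h2.congr_left fun w => ?_).congr_right fun w => one_mul _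
    ring
  · classical
    have h1 : (fun w => (w - α j) ^ (N + 1)) =O[𝓝 (α j)] fun w => ‖w - α j‖ ^ (N + 1) :=
      ((isBigO_refl (fun w => w - α j) _).norm_right).pow _
    have h2 : ContDiff ℂ ω fun w => c * (w - b) ^ k * ((w / b) ^ M * (((b - α j) ^ (N + 1))⁻¹ *
        ∏ i ∈ Finset.univ.erase j, ((w - α i) / (b - α i)) ^ (N + 1))) := by
      simp only [div_eq_mul_inv]
      fun_prop
    refine (isBigO_mul_contDiff h1 h2).congr_left fun w => ?_
    simp only [A]
    rw [← Finset.prod_erase_mul _ _ (Finset.mem_univ j), div_pow (w - α j), div_eq_mul_inv (_ ^ _)]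
    generalize ∏ i ∈ Finset.univ.erase j, ((w - α i) / (b - α i)) ^ (N + 1) = B
    ring

variable [Fintype ι] {a : ι → EuclideanSpace ℂ (Fin n)} {R : ℝ}

lemma exists_subset_closedBall_of_isCompact {L : Set (EuclideanSpace ℂ (Fin n))} (hR : 0 < R)
    (hL : IsCompact L) (hLR : L ⊆ Metric.ball 0 R) : ∃ r, 0 ≤ r ∧ r < R ∧ ∀ z ∈ L, ‖z‖ ≤ r := by
  rcases L.eq_empty_or_nonempty with rfl | hne
  · exact ⟨0, le_rfl, hR, by simp⟩
  obtain ⟨x, hx, hmax⟩ := hL.exists_isMaxOn hne continuous_norm.continuousOn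
  exact ⟨‖x‖, norm_nonneg _, by simpa using hLR hx, fun z hz => hmax hz⟩

lemma isBigO_comp_apply {h : ℂ → ℂ} {b : EuclideanSpace ℂ (Fin n)} {k : ℕ} (j : Fin n)
    (hh : h =O[𝓝 (b j)] fun w => ‖w - b j‖ ^ k) :
    (fun z : EuclideanSpace ℂ (Fin n) => h (z j)) =O[𝓝 b] fun z => ‖z - b‖ ^ k := by
  have hc : Tendsto (fun z : EuclideanSpace ℂ (Fin n) => z j) (𝓝 b) (𝓝 (b j)) :=
    (by fun_prop : Continuous fun z : EuclideanSpace ℂ (Fin n) => z j).tendsto b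
  refine (hh.comp_tendsto hc).trans (IsBigO.of_bound 1 (.of_forall fun z => ?_))
  simp only [Function.comp, norm_pow, norm_norm, one_mul]
  gcongr
  exact PiLp.norm_apply_le (z - b) j

lemma nearId_shear (hR : 0 < R) (ha : ∀ j, ‖a j‖ < R) (N k : ℕ) (c : ℂ) {i j : Fin n}
    (hij : i ≠ j) {q : EuclideanSpace ℂ (Fin n)} (hq : R ≤ ‖q j‖) :
    NearId (jetAut a N) (Metric.ball 0 R) fun σ => ∃ h : ℂ → ℂ, ContDiff ℂ ω h ∧
      ((fun w => h w - c * (w - q j) ^ k) =o[𝓝 (q j)] fun w => (w - q j) ^ k) ∧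
      ∀ z, σ z = z + h (z j) • EuclideanSpace.single i 1 := by
  intro L hLR hL ε hε
  obtain ⟨r, hr0, hrR, hLr⟩ := exists_subset_closedBall_of_isCompact hR hL hLR
  obtain ⟨h, hcd, hsmall, hlead, hjet⟩ := exists_entire_leading_term hR hr0 hrR hε hq
    (fun t => a t j) (fun t => (PiLp.norm_apply_le (a t) j).trans_lt (ha t)) N k c
  obtain ⟨σ, hσ, h1, h2⟩ := exists_shear (a := a) (N := N) (u := EuclideanSpace.single i 1)
    (f := fun z => h (z j)) (by fun_prop) (by simp [hij.symm])
    (fun t => isBigO_comp_apply j (hjet t))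
  refine ⟨σ, hσ, ⟨h, hcd, hlead, h1⟩, fun z hz => ?_⟩
  have h3 := hsmall (z j) ((PiLp.norm_apply_le z j).trans (hLr z hz))
  rw [h1, h2]
  simpa [norm_smul] using h3

lemma nearId_overshear (hR : 0 < R) (ha : ∀ j, ‖a j‖ < R) (N k : ℕ) (c b : ℂ) {i j : Fin n}
    (hij : i ≠ j) {q : EuclideanSpace ℂ (Fin n)} (hq : R ≤ ‖q j‖) :
    NearId (jetAut a N) (Metric.ball 0 R) fun σ => ∃ h : ℂ → ℂ, ContDiff ℂ ω h ∧
      ((fun w => h w - c * (w - q j) ^ k) =o[𝓝 (q j)] fun w => (w - q j) ^ k) ∧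
      ∀ z, σ z = z + ((Complex.exp (h (z j)) - 1) * (z i - b)) • EuclideanSpace.single i 1 := by
  intro L hLR hL ε hε
  obtain ⟨r, hr0, hrR, hLr⟩ := exists_subset_closedBall_of_isCompact hR hL hLR
  set D := 2 * (r + ‖b‖) + 1 with hD
  have hD0 : 0 < D := by positivity
  obtain ⟨h, hcd, hsmall, hlead, hjet⟩ := exists_entire_leading_term (ε := min 1 (ε / D)) hR hr0
    hrR (by positivity) hq (fun t => a t j) (fun t => (PiLp.norm_apply_le (a t) j).trans_lt (ha t)) N k c
  obtain ⟨σ, hσ, h1, h2⟩ := exists_overshear (a := a) (N := N) (u := EuclideanSpace.single i 1)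
    (f := fun z => h (z j)) (l := fun z => z i - b) (by fun_prop) (by fun_prop)
    (by simp [hij.symm]) (fun z s => by simp; ring) (fun t => isBigO_comp_apply j (hjet t))
  have key : ∀ z ∈ L, ∀ w : ℂ, ‖w‖ < min 1 (ε / D) →
      ‖(Complex.exp w - 1) * (z i - b)‖ < ε := by
    intro z hz w hw
    have h3 := Complex.norm_exp_sub_one_le (hw.le.trans (min_le_left _ _))
    have h4 : ‖w‖ * D < ε := (lt_div_iff₀ hD0).mp (hw.trans_le (min_le_right _ _))
    have h5 : ‖z i - b‖ ≤ r + ‖b‖ :=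
      (norm_sub_le _ _).trans (by linarith [PiLp.norm_apply_le z i, hLr z hz])
    rw [norm_mul]
    calc _ ≤ (2 * ‖w‖) * (r + ‖b‖) := by gcongr
      _ ≤ ‖w‖ * D := by rw [hD]; linarith [norm_nonneg w]
      _ < ε := h4
  refine ⟨σ, hσ, ⟨h, hcd, hlead, h1⟩, fun z hz => ?_⟩
  have h3 := hsmall (z j) ((PiLp.norm_apply_le z j).trans (hLr z hz))
  rw [h1, h2]
  exact ⟨by simpa [norm_smul] using key z hz _ h3,
    by simpa [norm_smul] using key z hz (-h (z j)) (by rwa [norm_neg])⟩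

lemma nearId_true {E : Type*} [NormedAddCommGroup E] (G : Subgroup (Equiv.Perm E)) (U : Set E)
    {T : Equiv.Perm E → Prop} (h : T 1) : NearId G U T :=
  fun L _ _ ε hε => ⟨1, G.one_mem, h, fun z _ => by simpa using hε⟩

lemma exists_ne_of_two_le (hn : 2 ≤ n) (i : Fin n) : ∃ j, i ≠ j := by
  have : Nontrivial (Fin n) := Fin.nontrivial_iff_two_le.mpr hn
  obtain ⟨j, hj⟩ := exists_ne i
  exact ⟨j, hj.symm⟩

/-- Points all of whose coordinates are large can be mapped to each other. -/
lemma nearId_apply_eq (hn : 2 ≤ n) (hR : 0 < R) (ha : ∀ j, ‖a j‖ < R) (N : ℕ)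
    {p q : EuclideanSpace ℂ (Fin n)} (hp : ∀ i, R ≤ ‖p i‖) (hq : ∀ i, R ≤ ‖q i‖) :
    NearId (jetAut a N) (Metric.ball 0 R) fun σ => σ p = q := by
  have step : ∀ (x : EuclideanSpace ℂ (Fin n)), (∀ i, R ≤ ‖x i‖) → ∀ (i : Fin n) (c : ℂ),
      NearId (jetAut a N) (Metric.ball 0 R) fun σ => σ x = x + c • EuclideanSpace.single i 1 := by
    intro x hx i c
    obtain ⟨j, hij⟩ := exists_ne_of_two_le hn i
    refine (nearId_shear hR ha N 0 c hij (hx j)).mono ?_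
    rintro σ - ⟨h, -, h1, h2⟩
    have h3 : h (x j) = c := by
      have h5 : ∀ ε > 0, ‖h (x j) - c‖ ≤ ε := fun ε hε => by
        simpa using (isLittleO_iff.mp h1 hε).self_of_nhds
      exact sub_eq_zero.mp (norm_le_zero_iff.mp (le_of_forall_pos_le_add (by simpa using h5)))
    rw [h2, h3]
  have main : ∀ s : Finset (Fin n), NearId (jetAut a N) (Metric.ball 0 R) fun σ =>
      σ p = WithLp.toLp 2 (s.piecewise q p) := by
    intro s
    induction s using Finset.induction_on with
    | empty => exact nearId_true _ _ (by simp)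
    | insert i s his ih =>
      refine NearId.mul Metric.isOpen_ball ih
        (fun _ _ _ => step (WithLp.toLp 2 (s.piecewise q p)) (fun t => ?_) i (q i - p i)) ?_
      · simp only [Finset.piecewise]
        split_ifs
        exacts [hq t, hp t]
      · intro σ _ τ _ h1 h2
        rw [Equiv.Perm.mul_apply, h1, h2]
        ext t
        by_cases hti : t = i
        · subst hti
          simp [his]
        · simp [hti, Finset.piecewise]
  refine (main Finset.univ).mono fun σ _ h => ?_
  rw [h]
  simp

end CoordinateShears

section LinearJets

open Topology
open scoped ContDiff

variable {n : ℕ} {ι : Type*} [Fintype ι] {a : ι → EuclideanSpace ℂ (Fin n)} {R : ℝ}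

lemma eq_zero_of_isLittleO {h : ℂ → ℂ} {b c : ℂ} {k : ℕ} (hk : k ≠ 0)
    (hh : (fun w => h w - c * (w - b) ^ k) =o[𝓝 b] fun w => (w - b) ^ k) : h b = 0 := by
  simpa [hk] using (isLittleO_iff.mp hh one_pos).self_of_nhds

/-- Any invertible linear map is the derivative of a map in the group at a point all of whose
coordinates are large. -/
lemma nearId_hasFDerivAt (hn : 2 ≤ n) (hR : 0 < R) (ha : ∀ j, ‖a j‖ < R) (N : ℕ)
    {q : EuclideanSpace ℂ (Fin n)} (hq : ∀ i, R ≤ ‖q i‖)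
    (M : EuclideanSpace ℂ (Fin n) ≃L[ℂ] EuclideanSpace ℂ (Fin n)) :
    NearId (jetAut a N) (Metric.ball 0 R) fun σ => σ q = q ∧
      HasFDerivAt σ (M : EuclideanSpace ℂ (Fin n) →L[ℂ] EuclideanSpace ℂ (Fin n)) q := by
  let P : Matrix (Fin n) (Fin n) ℂ → Prop := fun M =>
    NearId (jetAut a N) (Metric.ball 0 R) fun σ => σ q = q ∧
      HasFDerivAt σ (Matrix.toEuclideanCLM (n := Fin n) (𝕜 := ℂ) M) q
  have hone : P 1 := nearId_true _ _ ⟨rfl, by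
    rw [map_one]
    exact hasFDerivAt_id q⟩
  have hmul : ∀ A B, P A → P B → P (A * B) := by
    intro A B hA hB
    refine NearId.mul Metric.isOpen_ball hB (fun _ _ _ => hA) ?_
    rintro σ - τ - ⟨h1, h2⟩ ⟨h3, h4⟩
    refine ⟨by rw [Equiv.Perm.mul_apply, h1, h3], ?_⟩
    rw [map_mul]
    rw [← h1] at h4
    exact h4.comp q h2
  have happly : ∀ (i : Fin n), HasFDerivAt (fun z : EuclideanSpace ℂ (Fin n) => z i)
      (EuclideanSpace.proj i : EuclideanSpace ℂ (Fin n) →L[ℂ] ℂ) q := fun i =>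
    (EuclideanSpace.proj i : EuclideanSpace ℂ (Fin n) →L[ℂ] ℂ).hasFDerivAt
  have htrans : ∀ t : Matrix.TransvectionStruct (Fin n) ℂ, P t.toMatrix := by
    rintro ⟨i, j, hij, c⟩
    refine (nearId_shear hR ha N 1 c hij (hq j)).mono ?_
    rintro σ - ⟨h, -, h1, h2⟩
    have h0 := eq_zero_of_isLittleO one_ne_zero h1
    have hd : HasDerivAt h c (q j) := by
      rw [hasDerivAt_iff_isLittleO]
      simpa [h0, mul_comm] using h1
    refine ⟨by rw [h2, h0, zero_smul, add_zero], ?_⟩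
    have h3 := (hasFDerivAt_id q).add
      ((hd.comp_hasFDerivAt q (happly j)).smul_const (EuclideanSpace.single i (1 : ℂ)))
    refine (h3.congr_of_eventuallyEq (.of_forall h2)).congr_fderiv (Eq.symm ?_)
    ext y t
    rcases eq_or_ne t i with rfl | hti
    · simp [Matrix.TransvectionStruct.toMatrix, Matrix.transvection, Matrix.mulVec, dotProduct,
        Matrix.single_apply]
    · simp [Matrix.TransvectionStruct.toMatrix, Matrix.transvection, Matrix.mulVec, dotProduct,
        Matrix.single_apply, hti, hti.symm]
  have hdiag1 : ∀ (i : Fin n) (d : ℂ), d ≠ 0 →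
      P (Matrix.diagonal (Function.update (1 : Fin n → ℂ) i d)) := by
    intro i d hd
    obtain ⟨j, hij⟩ := exists_ne_of_two_le hn i
    refine (nearId_overshear hR ha N 0 (Complex.log d) (q i) hij (hq j)).mono ?_
    rintro σ - ⟨h, hcd, h1, h2⟩
    have h0 : h (q j) = Complex.log d := by
      have h5 : ∀ ε > 0, ‖h (q j) - Complex.log d‖ ≤ ε := fun ε hε => by
        simpa using (isLittleO_iff.mp h1 hε).self_of_nhds
      exact sub_eq_zero.mp (norm_le_zero_iff.mp (le_of_forall_pos_le_add (by simpa using h5)))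
    refine ⟨by rw [h2, sub_self, mul_zero, zero_smul, add_zero], ?_⟩
    have hh : HasFDerivAt (fun z : EuclideanSpace ℂ (Fin n) => Complex.exp (h (z j)) - 1)
        (fderiv ℂ (fun z : EuclideanSpace ℂ (Fin n) => Complex.exp (h (z j)) - 1) q) q := by
      have : ContDiff ℂ ω fun z : EuclideanSpace ℂ (Fin n) => Complex.exp (h (z j)) - 1 := by
        fun_prop
      exact (this.differentiable (by simp) q).hasFDerivAt
    have h3 := (hasFDerivAt_id q).add
      ((hh.mul ((happly i).sub_const (q i))).smul_const (EuclideanSpace.single i (1 : ℂ)))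
    refine (h3.congr_of_eventuallyEq (.of_forall h2)).congr_fderiv (Eq.symm ?_)
    ext y t
    rcases eq_or_ne t i with rfl | hti
    · simp [Matrix.mulVec_diagonal, h0, Complex.exp_log hd]
      ring
    · simp [Matrix.mulVec_diagonal, hti]
  have hdiag : ∀ D : Fin n → ℂ, Matrix.det (Matrix.diagonal D) ≠ 0 → P (Matrix.diagonal D) := by
    intro D hD
    rw [Matrix.det_diagonal, Finset.prod_ne_zero_iff] at hD
    have main : ∀ s : Finset (Fin n), P (Matrix.diagonal (s.piecewise D 1)) := by
      intro s
      induction s using Finset.induction_on with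
      | empty => simpa using hone
      | insert i s his ih =>
        convert hmul _ _ (hdiag1 i (D i) (hD i (Finset.mem_univ i))) ih using 1
        rw [Matrix.diagonal_mul_diagonal]
        congr 1
        ext t
        by_cases hti : t = i
        · subst hti
          simp [his]
        · simp [hti, Finset.piecewise]
    simpa using main Finset.univ
  obtain ⟨M', hM'⟩ := (Matrix.toEuclideanCLM (n := Fin n) (𝕜 := ℂ)).surjective
    (M : EuclideanSpace ℂ (Fin n) →L[ℂ] EuclideanSpace ℂ (Fin n))
  obtain ⟨M'', hM''⟩ := (Matrix.toEuclideanCLM (n := Fin n) (𝕜 := ℂ)).surjective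
    (M.symm : EuclideanSpace ℂ (Fin n) →L[ℂ] EuclideanSpace ℂ (Fin n))
  have hdet : M'.det ≠ 0 := by
    have : M' * M'' = 1 := by
      apply (Matrix.toEuclideanCLM (n := Fin n) (𝕜 := ℂ)).injective
      rw [map_mul, hM', hM'', map_one]
      ext1 y
      simp
    intro h0
    simpa [h0] using congrArg Matrix.det this
  rw [← hM']
  exact Matrix.diagonal_transvection_induction_of_det_ne_zero P M' hdet hdiag htrans
    fun A B _ _ hA hB => hmul A B hA hB

end LinearJets

section HomogeneousMaps

open Topology
open scoped ContDiff

variable {n : ℕ}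

/-- If a polynomial with vector coefficients takes values in a subspace infinitely often, then
its coefficients belong to that subspace. -/
lemma Submodule.mem_of_infinite_sum_pow_smul_mem {V : Type*} [AddCommGroup V] [Module ℂ V]
    (W : Submodule ℂ V) {h : ℕ → V} {d : ℕ}
    (hs : {s : ℂ | ∑ m ∈ Finset.range d, s ^ m • h m ∈ W}.Infinite) {m : ℕ} (hm : m < d) :
    h m ∈ W := by
  by_contra hmW
  obtain ⟨φ, hφ, hφW⟩ := Submodule.exists_le_ker_of_notMem hmW
  let P : Polynomial ℂ := ∑ m ∈ Finset.range d, Polynomial.monomial m (φ (h m))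
  have hP : P = 0 := by
    refine Polynomial.eq_zero_of_infinite_isRoot P (hs.mono fun s hs => ?_)
    have h1 : φ (∑ m ∈ Finset.range d, s ^ m • h m) = 0 := hφW hs
    simp only [map_sum, map_smul, smul_eq_mul] at h1
    simp only [Set.mem_ofPred_eq, Polynomial.IsRoot.def, P, Polynomial.eval_finsetSum,
      Polynomial.eval_monomial]
    rw [← h1]
    exact Finset.sum_congr rfl fun _ _ => mul_comm _ _
  have h2 : P.coeff m = φ (h m) := by
    simp [P, Polynomial.coeff_monomial, hm]
  exact hφ (by rw [← h2, hP, Polynomial.coeff_zero])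

/-- Replacing the `j`-th coordinate by a linear functional. -/
lemma exists_equiv_replace_coord (ν : EuclideanSpace ℂ (Fin n) →L[ℂ] ℂ) {j : Fin n}
    (hν : ν (EuclideanSpace.single j 1) ≠ 0) :
    ∃ M : EuclideanSpace ℂ (Fin n) ≃L[ℂ] EuclideanSpace ℂ (Fin n),
      (∀ y, M y j = ν y) ∧ (∀ i ≠ j, ∀ y, M y i = y i) ∧
      ∀ i ≠ j, ν (EuclideanSpace.single j 1) • M.symm (EuclideanSpace.single i 1) =
        ν (EuclideanSpace.single j 1) • EuclideanSpace.single i 1 -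
          ν (EuclideanSpace.single i 1) • EuclideanSpace.single j 1 := by
  set e := EuclideanSpace.single (𝕜 := ℂ) j (1 : ℂ) with he
  let pj : EuclideanSpace ℂ (Fin n) →L[ℂ] ℂ := EuclideanSpace.proj j
  let A : EuclideanSpace ℂ (Fin n) →L[ℂ] EuclideanSpace ℂ (Fin n) :=
    ContinuousLinearMap.id ℂ _ + (ν - pj).smulRight e
  let B : EuclideanSpace ℂ (Fin n) →L[ℂ] EuclideanSpace ℂ (Fin n) :=
    ContinuousLinearMap.id ℂ _ - ((ν e)⁻¹ • (ν - pj)).smulRight e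
  have hpe : pj e = 1 := by simp [pj, he]
  have hA : ∀ y, A y = y + (ν y - pj y) • e := fun y => rfl
  have hB : ∀ y, B y = y - ((ν e)⁻¹ * (ν y - pj y)) • e := fun y => rfl
  let M : EuclideanSpace ℂ (Fin n) ≃L[ℂ] EuclideanSpace ℂ (Fin n) :=
    ContinuousLinearEquiv.equivOfInverse A B
      (fun y => by
        rw [hB, hA]
        simp only [map_add, map_smul, hpe, smul_eq_mul]
        rw [add_sub_assoc, ← sub_smul]
        convert add_zero y
        convert zero_smul ℂ e
        field_simp
        ring)
      (fun y => by
        rw [hA, hB]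
        simp only [map_sub, map_smul, hpe, smul_eq_mul]
        rw [sub_add, ← sub_smul]
        convert sub_zero y
        convert zero_smul ℂ e
        field_simp
        ring)
  refine ⟨M, fun y => ?_, fun i hi y => ?_, fun i hi => ?_⟩
  · change (A y) j = _
    rw [hA]
    simp [pj, he]
  · change (A y) i = _
    rw [hA]
    simp [he, hi]
  · change ν e • B _ = _
    have : pj (EuclideanSpace.single i 1) = 0 := by simp [pj, hi.symm]
    rw [hB, this, sub_zero, smul_sub, smul_smul, mul_inv_cancel_left₀ hν]

variable {k : ℕ} (W : Submodule ℂ (EuclideanSpace ℂ (Fin n) → EuclideanSpace ℂ (Fin n)))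

/-- A space of maps that is invariant under linear conjugation and contains the homogeneous
shears and overshears of degree `k + 1` contains all powers of functionals. -/
lemma pow_smul_single_mem (hn : 2 ≤ n)
    (hsh : ∀ i j, i ≠ j → (fun y => y j ^ (k + 1) • EuclideanSpace.single i 1) ∈ W)
    (hov : ∀ i j, i ≠ j → (fun y => (y j ^ k * y i) • EuclideanSpace.single i 1) ∈ W)
    (hconj : ∀ M : EuclideanSpace ℂ (Fin n) ≃L[ℂ] EuclideanSpace ℂ (Fin n), ∀ H ∈ W,
      (fun y => M.symm (H (M y))) ∈ W)
    (ν : EuclideanSpace ℂ (Fin n) →L[ℂ] ℂ) {j : Fin n}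
    (hν : ν (EuclideanSpace.single j 1) ≠ 0) :
    (fun y => ν y ^ (k + 1) • EuclideanSpace.single j 1) ∈ W := by
  obtain ⟨i, hji⟩ := exists_ne_of_two_le hn j
  have hij := hji.symm
  set ei := EuclideanSpace.single (𝕜 := ℂ) i (1 : ℂ) with hei
  set ej := EuclideanSpace.single (𝕜 := ℂ) j (1 : ℂ) with hej
  let pi' : EuclideanSpace ℂ (Fin n) →L[ℂ] ℂ := EuclideanSpace.proj i
  have ha : ∀ ν : EuclideanSpace ℂ (Fin n) →L[ℂ] ℂ, ν ej ≠ 0 →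
      (fun y => ν y ^ (k + 1) • (ν ej • ei - ν ei • ej)) ∈ W := by
    intro ν hν
    obtain ⟨M, h1, h2, h3⟩ := exists_equiv_replace_coord ν hν
    convert W.smul_mem (ν ej) (hconj M _ (hsh i j hij)) using 1
    funext y
    simp only [Pi.smul_apply, map_smul, h1]
    rw [smul_comm, h3 i hij]
  have hb : (fun y => (ν y ^ k * y i) • (ν ej • ei - ν ei • ej)) ∈ W := by
    obtain ⟨M, h1, h2, h3⟩ := exists_equiv_replace_coord ν hν
    convert W.smul_mem (ν ej) (hconj M _ (hov i j hij)) using 1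
    funext y
    simp only [Pi.smul_apply, map_smul, h1, h2 i hij]
    rw [smul_comm, h3 i hij]
  let A : ℕ → EuclideanSpace ℂ (Fin n) → EuclideanSpace ℂ (Fin n) := fun m y =>
    (y i ^ m * ν y ^ (k + 1 - m) * ((k + 1).choose m : ℂ)) • (ν ej • ei - ν ei • ej)
  let B : ℕ → EuclideanSpace ℂ (Fin n) → EuclideanSpace ℂ (Fin n)
    | 0 => 0
    | m + 1 => fun y => -((y i ^ m * ν y ^ (k + 1 - m) * ((k + 1).choose m : ℂ)) • ej)
  have hpe : pi' ei = 1 := by simp [pi', hei]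
  have hpe' : pi' ej = 0 := by simp [pi', hej, hij]
  have hsum : ∀ s : ℂ, ∑ m ∈ Finset.range (k + 3), s ^ m • (A m + B m) ∈ W := by
    intro s
    have hνs : (ν + s • pi') ej ≠ 0 := by simpa [hpe'] using hν
    convert ha _ hνs using 1
    have hbin : ∀ y, (ν + s • pi') y ^ (k + 1) = ∑ m ∈ Finset.range (k + 2),
        s ^ m * (y i ^ m * ν y ^ (k + 1 - m) * ((k + 1).choose m : ℂ)) := by
      intro y
      have : (ν + s • pi') y = s * y i + ν y := by simp [pi', add_comm]
      rw [this, add_pow]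
      exact Finset.sum_congr rfl fun m _ => by ring
    funext y
    simp only [smul_add, Finset.sum_add_distrib]
    rw [Finset.sum_range_succ _ (k + 2), Finset.sum_range_succ' _ (k + 2)]
    simp only [Pi.add_apply, Finset.sum_apply, Pi.smul_apply, hbin, A, B]
    have h1 : (ν + s • pi') ej • ei - (ν + s • pi') ei • ej =
        (ν ej • ei - ν ei • ej) - s • ej := by
      simp [hpe, hpe', add_smul, sub_sub]
    rw [h1]
    generalize ν ej • ei - ν ei • ej = w₀
    rw [smul_sub, Finset.sum_smul, Finset.sum_smul]
    simp [smul_smul, sub_eq_add_neg, pow_succ, mul_comm, mul_left_comm, mul_assoc]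
  have h1 : A 1 + B 1 ∈ W := by
    refine W.mem_of_infinite_sum_pow_smul_mem (h := fun m => A m + B m) (d := k + 3) ?_
      (by omega)
    simp only [hsum, Set.ofPred_true]
    exact Set.infinite_univ
  convert W.sub_mem (W.smul_mem ((k : ℂ) + 1) hb) h1 using 1
  funext y
  simp only [Pi.sub_apply, Pi.smul_apply, Pi.add_apply, A, B]
  simp only [smul_smul, Nat.choose_one_right, Nat.choose_zero_right, Nat.add_sub_cancel]
  simp [mul_comm]

/-- A space of maps that is invariant under linear conjugation and contains the homogeneous
shears and overshears of degree `k + 1` contains all homogeneous polynomial maps of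
that degree. -/
lemma multilinear_diag_mem (hn : 2 ≤ n)
    (hsh : ∀ i j, i ≠ j → (fun y => y j ^ (k + 1) • EuclideanSpace.single i 1) ∈ W)
    (hov : ∀ i j, i ≠ j → (fun y => (y j ^ k * y i) • EuclideanSpace.single i 1) ∈ W)
    (hconj : ∀ M : EuclideanSpace ℂ (Fin n) ≃L[ℂ] EuclideanSpace ℂ (Fin n), ∀ H ∈ W,
      (fun y => M.symm (H (M y))) ∈ W)
    (A : MultilinearMap ℂ (fun _ : Fin (k + 1) => EuclideanSpace ℂ (Fin n))
      (EuclideanSpace ℂ (Fin n))) :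
    (fun y => A fun _ => y) ∈ W := by
  have hpol : ∀ (l : List (EuclideanSpace ℂ (Fin n) →L[ℂ] ℂ)) (r : ℕ), r + l.length = k + 1 →
      ∀ (j : Fin n) (ν : EuclideanSpace ℂ (Fin n) →L[ℂ] ℂ),
        ν (EuclideanSpace.single j 1) ≠ 0 →
        (fun y => (ν y ^ r * (l.map fun μ => μ y).prod) • EuclideanSpace.single j 1) ∈ W := by
    intro l
    induction l with
    | nil =>
      intro r hr j ν hν
      obtain rfl : r = k + 1 := by simpa using hr
      simpa using pow_smul_single_mem W hn hsh hov hconj ν hν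
    | cons μ l ih =>
      intro r hr j ν hν
      have hr' : r + 1 + l.length = k + 1 := by simpa [add_assoc, add_comm] using hr
      let h : ℕ → EuclideanSpace ℂ (Fin n) → EuclideanSpace ℂ (Fin n) := fun m y =>
        (μ y ^ m * ν y ^ (r + 1 - m) * ((r + 1).choose m : ℂ) * (l.map fun μ => μ y).prod) •
          EuclideanSpace.single j 1
      have h1 : h 1 ∈ W := by
        refine W.mem_of_infinite_sum_pow_smul_mem (h := h) (d := r + 2) ?_ (by omega)
        set b := ν (EuclideanSpace.single j 1) with hb
        set c := μ (EuclideanSpace.single j 1) with hc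
        have hfin : {s : ℂ | b + s * c = 0}.Finite := by
          refine Set.Subsingleton.finite fun s hs t ht => ?_
          have hs' : b + s * c = 0 := hs
          have ht' : b + t * c = 0 := ht
          have hc0 : c ≠ 0 := by
            intro h0
            rw [h0, mul_zero, add_zero] at hs'
            exact hν hs'
          exact mul_right_cancel₀ hc0 (add_left_cancel (hs'.trans ht'.symm))
        refine hfin.infinite_compl.mono fun s hs => ?_
        have := ih (r + 1) hr' j (ν + s • μ) (by simpa [← hb, ← hc] using hs)
        change _ ∈ W
        convert this using 1
        funext y
        have hν' : (ν + s • μ) y = s * μ y + ν y := by simp [add_comm]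
        simp only [Finset.sum_apply, Pi.smul_apply, h, hν', add_pow, Finset.sum_mul,
          Finset.sum_smul, smul_smul]
        exact Finset.sum_congr rfl fun m _ => by ring_nf
      convert W.smul_mem ((r + 1 : ℂ)⁻¹) h1 using 1
      funext y
      have : (r + 1 : ℂ) ≠ 0 := by exact_mod_cast Nat.succ_ne_zero r
      simp only [Pi.smul_apply, h, smul_smul, List.map_cons, List.prod_cons,
        Nat.choose_one_right, Nat.add_sub_cancel]
      congr 1
      push_cast
      field_simp
  have hprod : ∀ (f : Fin (k + 1) → Fin n) (j : Fin n),
      (fun y : EuclideanSpace ℂ (Fin n) => (∏ l, y (f l)) • EuclideanSpace.single j (1 : ℂ)) ∈ W := by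
    intro f j
    have := hpol (List.ofFn fun l => (EuclideanSpace.proj (f l) : EuclideanSpace ℂ (Fin n) →L[ℂ] ℂ))
      0 (by simp) j (EuclideanSpace.proj j) (by simp)
    simpa [List.map_ofFn, Function.comp_def, List.prod_ofFn, -Fin.prod_univ_succ,
      -List.ofFn_succ] using this
  have hexp : (fun y => A fun _ => y) = ∑ f : Fin (k + 1) → Fin n, ∑ j,
      (A fun l => EuclideanSpace.single (f l) 1) j •
        fun y : EuclideanSpace ℂ (Fin n) => (∏ l, y (f l)) • EuclideanSpace.single j (1 : ℂ) := by
    funext y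
    have hy : y = ∑ i, y i • EuclideanSpace.single i (1 : ℂ) := by
      conv_lhs => rw [← (EuclideanSpace.basisFun (Fin n) ℂ).sum_repr y]
      simp
    conv_lhs => rw [hy]
    rw [MultilinearMap.map_sum]
    simp only [Finset.sum_apply, Pi.smul_apply]
    refine Finset.sum_congr rfl fun f _ => ?_
    rw [MultilinearMap.map_smul_univ A (fun l => y (f l)) fun l => EuclideanSpace.single (f l) 1]
    have hz : ∀ z : EuclideanSpace ℂ (Fin n), z = ∑ i, z i • EuclideanSpace.single i (1 : ℂ) := by
      intro z
      conv_lhs => rw [← (EuclideanSpace.basisFun (Fin n) ℂ).sum_repr z]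
      simp
    conv_lhs => rw [hz (A _), Finset.smul_sum]
    exact Finset.sum_congr rfl fun j _ => smul_comm _ _ _
  rw [hexp]
  exact W.sum_mem fun f _ => W.sum_mem fun j _ => W.smul_mem _ (hprod f j)

end HomogeneousMaps

section LeadingJets

open Topology
open scoped ContDiff

variable {E : Type*} [NormedAddCommGroup E] [NormedSpace ℂ E] {k : ℕ}

lemma multilinear_diag_isBigO (A : ContinuousMultilinearMap ℂ (fun _ : Fin k => E) E)
    {α : Type*} {l : Filter α} {f : α → E} :
    (fun x => A fun _ => f x) =O[l] fun x => ‖f x‖ ^ k :=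
  IsBigO.of_bound ‖A‖ (.of_forall fun x => by simpa using A.le_opNorm fun _ => f x)

lemma multilinear_diag_sub_isLittleO
    (A : ContinuousMultilinearMap ℂ (fun _ : Fin (k + 1) => E) E)
    {α F : Type*} [NormedAddCommGroup F] {l : Filter α} {f g : α → E} {d : α → F}
    (hf : f =O[l] d) (hg : g =O[l] d) (hfg : (fun x => f x - g x) =o[l] d) :
    (fun x => (A fun _ => f x) - A fun _ => g x) =o[l] fun x => ‖d x‖ ^ (k + 1) := by
  have h1 : (fun x => (A fun _ => f x) - A fun _ => g x) =O[l]
      fun x => (‖f x‖ + ‖g x‖) ^ k * ‖f x - g x‖ := by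
    refine IsBigO.of_bound (‖A‖ * (k + 1)) (.of_forall fun x => ?_)
    refine (A.norm_image_sub_le _ _).trans ?_
    have h2 : ‖(fun _ => f x : Fin (k + 1) → E) - fun _ => g x‖ = ‖f x - g x‖ := by
      change ‖fun _ : Fin (k + 1) => f x - g x‖ = _
      exact pi_norm_const _
    rw [h2, pi_norm_const, pi_norm_const, Fintype.card_fin, Nat.add_sub_cancel, mul_assoc,
      Real.norm_of_nonneg (by positivity), Nat.cast_add_one]
    gcongr
    exact max_le_add_of_nonneg (norm_nonneg _) (norm_nonneg _)
  refine h1.trans_isLittleO ?_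
  simp only [pow_succ]
  exact ((hf.norm_norm.add hg.norm_norm).pow k).mul_isLittleO hfg.norm_norm

/-- `σ z = z + A (z - q, …, z - q) + o(‖z - q‖ ^ k)` at `q`, where `A` is homogeneous of
degree `k`. -/
def HasLeadingJet (σ : E → E) (q : E) (A : ContinuousMultilinearMap ℂ (fun _ : Fin k => E) E) :
    Prop :=
  (fun z => σ z - z - A fun _ => z - q) =o[𝓝 q] fun z => ‖z - q‖ ^ k

namespace HasLeadingJet

lemma isBigO {σ : E → E} {q : E} {A : ContinuousMultilinearMap ℂ (fun _ : Fin k => E) E}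
    (h : HasLeadingJet σ q A) : (fun z => σ z - z) =O[𝓝 q] fun z => ‖z - q‖ ^ k :=
  (IsLittleO.isBigO h |>.add (multilinear_diag_isBigO A)).congr_left fun z => by abel

lemma apply_self {σ : E → E} {q : E}
    {A : ContinuousMultilinearMap ℂ (fun _ : Fin (k + 1) => E) E}
    (h : HasLeadingJet σ q A) : σ q = q :=
  fixed_of_isBigO h.isBigO

lemma comp {σ τ : E → E} {q : E}
    {A B : ContinuousMultilinearMap ℂ (fun _ : Fin (k + 2) => E) E}
    (hσ : HasLeadingJet σ q A) (hτ : HasLeadingJet τ q B) (hd : DifferentiableAt ℂ σ q) :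
    HasLeadingJet (fun z => τ (σ z)) q (A + B) := by
  have h0 := hσ.apply_self
  have hc : Tendsto σ (𝓝 q) (𝓝 q) := by simpa [h0] using hd.continuousAt.tendsto
  have h1 : (fun z => σ z - q) =O[𝓝 q] fun z => z - q := by simpa [h0] using hd.isBigO_sub
  have h2 : (fun z => τ (σ z) - σ z - B fun _ => σ z - q) =o[𝓝 q] fun z => ‖z - q‖ ^ (k + 2) :=
    (IsLittleO.comp_tendsto hτ hc).trans_isBigO (h1.norm_norm.pow _)
  have h3 : (fun z => (σ z - q) - (z - q)) =o[𝓝 q] fun z => z - q := by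
    simp only [sub_sub_sub_cancel_right]
    refine hσ.isBigO.trans_isLittleO ?_
    exact isLittleO_norm_pow_id (by omega) |>.comp_tendsto (tendsto_sub_nhds_zero_iff.mpr tendsto_id)
  have h4 := multilinear_diag_sub_isLittleO B h1 (isBigO_refl _ _) h3
  refine ((h2.add h4).add hσ).congr_left fun z => ?_
  simp only [add_apply]
  abel

lemma conj {τ : E → E} {Λ : Equiv.Perm E} {q : E} {M : E ≃L[ℂ] E}
    {A : ContinuousMultilinearMap ℂ (fun _ : Fin (k + 2) => E) E}
    (hτ : HasLeadingJet τ q A) (hd : DifferentiableAt ℂ τ q) (hΛq : Λ q = q)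
    (hΛ : HasFDerivAt Λ (M : E →L[ℂ] E) q)
    (hΛ' : HasStrictFDerivAt (Λ⁻¹ : Equiv.Perm E) (M.symm : E →L[ℂ] E) q) :
    (fun z => Λ⁻¹ (τ (Λ z)) - z - M.symm (A fun _ => M (z - q))) =o[𝓝 q]
      fun z => ‖z - q‖ ^ (k + 2) := by
  have h0 := hτ.apply_self
  have hcτ : Tendsto τ (𝓝 q) (𝓝 q) := by simpa [h0] using hd.continuousAt.tendsto
  have hc : Tendsto Λ (𝓝 q) (𝓝 q) := by simpa [hΛq] using hΛ.continuousAt.tendsto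
  have h1 : (fun z => Λ z - q) =O[𝓝 q] fun z => z - q := by
    simpa [hΛq] using hΛ.differentiableAt.isBigO_sub
  have h2 : (fun z => τ (Λ z) - Λ z - A fun _ => Λ z - q) =o[𝓝 q] fun z => ‖z - q‖ ^ (k + 2) :=
    (IsLittleO.comp_tendsto hτ hc).trans_isBigO (h1.norm_norm.pow _)
  have h3 : (fun z => τ (Λ z) - Λ z) =O[𝓝 q] fun z => ‖z - q‖ ^ (k + 2) :=
    (hτ.isBigO.comp_tendsto hc).trans (h1.norm_norm.pow _)
  have h4 : (fun z => Λ⁻¹ (τ (Λ z)) - Λ⁻¹ (Λ z) - M.symm (τ (Λ z) - Λ z)) =o[𝓝 q]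
      fun z => ‖z - q‖ ^ (k + 2) :=
    (hΛ'.isLittleO.comp_tendsto ((hcτ.comp hc).prodMk_nhds hc)).trans_isBigO h3
  have h5 := (M.symm : E →L[ℂ] E).isBigO_comp (fun z => τ (Λ z) - Λ z - A fun _ => Λ z - q) (𝓝 q)
    |>.trans_isLittleO h2
  have h6 : (fun z => (Λ z - q) - M (z - q)) =o[𝓝 q] fun z => z - q := by
    simpa [hΛq] using hΛ.isLittleO
  have h7 := multilinear_diag_sub_isLittleO A h1 ((M : E →L[ℂ] E).isBigO_comp _ _) h6
  have h8 := (M.symm : E →L[ℂ] E).isBigO_comp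
    (fun z => (A fun _ => Λ z - q) - A fun _ => M (z - q)) (𝓝 q) |>.trans_isLittleO h7
  refine ((h4.add h5).add h8).congr_left fun z => ?_
  have h9 : Λ⁻¹ (Λ z) = z := by simp
  simp only [map_sub, ContinuousLinearEquiv.coe_coe, h9]
  abel

end HasLeadingJet

lemma NearId.conj [ProperSpace E] {G : Subgroup (Equiv.Perm E)} {U : Set E} (hU : IsOpen U)
    {T₁ T₂ T : Equiv.Perm E → Prop} (h₁ : NearId G U T₁) (h₂ : NearId G U T₂)
    (h : ∀ σ ∈ G, ∀ τ ∈ G, T₁ σ → T₂ τ → T (σ⁻¹ * (τ * σ))) : NearId G U T := by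
  intro L hLU hL ε hε
  obtain ⟨L', hL'U, hL', δ, hδ, hmul⟩ := exists_closeToId_mul hU hL hLU hε
  obtain ⟨L'', hL''U, hL'', δ', hδ', hmul'⟩ := exists_closeToId_mul hU hL' hL'U hδ
  obtain ⟨σ, hσ, h1, h2⟩ := h₁ (L' ∪ L'') (Set.union_subset hL'U hL''U) (hL'.union hL'')
    (min δ δ') (by positivity)
  obtain ⟨τ, hτ, h3, h4⟩ := h₂ L'' hL''U hL'' δ' hδ'
  exact ⟨_, G.mul_mem (G.inv_mem hσ) (G.mul_mem hτ hσ), h σ hσ τ hτ h1 h3,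
    hmul _ _ (h2.inv.mono Set.subset_union_left (min_le_left _ _))
      (hmul' _ _ h4 (h2.mono Set.subset_union_right (min_le_right _ _)))⟩

lemma jetAut.hasStrictFDerivAt_inv {ι : Type*} {a : ι → E} {N : ℕ} {σ : Equiv.Perm E}
    (hσ : σ ∈ jetAut a N) {q : E} {M : E ≃L[ℂ] E}
    (h : HasFDerivAt σ (M : E →L[ℂ] E) q) :
    HasStrictFDerivAt (σ⁻¹ : Equiv.Perm E) (M.symm : E →L[ℂ] E) (σ q) := by
  have h1 : HasFDerivAt (σ⁻¹ : Equiv.Perm E) (M.symm : E →L[ℂ] E) (σ q) :=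
    HasFDerivAt.of_local_left_inverse (jetAut.contDiff_inv hσ).continuous.continuousAt
      (by simpa using h) (.of_forall fun y => by simp)
  have h2 := (jetAut.contDiff_inv hσ).hasStrictFDerivAt (x := σ q) (by simp)
  rwa [h1.fderiv] at h2

variable {n : ℕ} {ι : Type*} [Fintype ι] {a : ι → EuclideanSpace ℂ (Fin n)} {R : ℝ}

/-- Every homogeneous polynomial map of degree at least two is the leading term of some
automorphism close to the identity. -/
lemma nearId_hasLeadingJet (hn : 2 ≤ n) (hR : 0 < R) (ha : ∀ j, ‖a j‖ < R) (N : ℕ)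
    {q : EuclideanSpace ℂ (Fin n)} (hq : ∀ i, R ≤ ‖q i‖)
    (A : EuclideanSpace ℂ (Fin n) [×k + 2]→L[ℂ] EuclideanSpace ℂ (Fin n)) :
    NearId (jetAut a N) (Metric.ball 0 R) fun σ => HasLeadingJet σ q A := by
  let J : (EuclideanSpace ℂ (Fin n) [×k + 2]→L[ℂ] EuclideanSpace ℂ (Fin n)) → Prop := fun A =>
    NearId (jetAut a N) (Metric.ball 0 R) fun σ => HasLeadingJet σ q A
  have hconj : ∀ (M : EuclideanSpace ℂ (Fin n) ≃L[ℂ] EuclideanSpace ℂ (Fin n))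
      (A B : EuclideanSpace ℂ (Fin n) [×k + 2]→L[ℂ] EuclideanSpace ℂ (Fin n)),
      (∀ y, (B fun _ => y) = M.symm (A fun _ => M y)) → J A → J B := by
    intro M A B hAB hA
    refine NearId.conj Metric.isOpen_ball (nearId_hasFDerivAt hn hR ha N hq M) hA ?_
    rintro σ hσ τ hτ ⟨h1, h2⟩ h3
    have h4 := jetAut.hasStrictFDerivAt_inv hσ h2
    rw [h1] at h4
    simpa only [HasLeadingJet, hAB, Equiv.Perm.mul_apply] using
      h3.conj ((jetAut.contDiff hτ).differentiable (by simp) q) h1 h2 h4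
  have hadd : ∀ A B, J A → J B → J (A + B) := fun A B hA hB =>
    NearId.mul Metric.isOpen_ball hA (fun _ _ _ => hB) fun σ hσ τ _ h1 h2 =>
      h1.comp h2 ((jetAut.contDiff hσ).differentiable (by simp) q)
  have hzero : J 0 := nearId_true _ _ (by simp [HasLeadingJet])
  have hsmul : ∀ (c : ℂ) A, J A → J (c • A) := by
    intro c A hA
    rcases eq_or_ne c 0 with rfl | hc
    · exact nearId_true _ _ (by simp [HasLeadingJet])
    obtain ⟨μ, hμ⟩ := IsAlgClosed.exists_pow_nat_eq c (n := k + 1) (by omega)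
    have hμ0 : μ ≠ 0 := by
      rintro rfl
      exact hc (by simpa using hμ.symm)
    refine hconj (ContinuousLinearEquiv.smulLeft (Units.mk0 μ hμ0)) A _ (fun y => ?_) hA
    have h1 := A.map_smul_univ (fun _ => μ) fun _ => y
    rw [ContinuousLinearEquiv.eq_symm_apply]
    simp only [Finset.prod_const, Finset.card_univ, Fintype.card_fin] at h1
    change μ • (c • A fun _ => y) = A fun _ => μ • y
    rw [h1, smul_smul, ← hμ, pow_succ' μ (k + 1)]
  let W : Submodule ℂ (EuclideanSpace ℂ (Fin n) → EuclideanSpace ℂ (Fin n)) :=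
    { carrier := {H | ∃ A : EuclideanSpace ℂ (Fin n) [×k + 2]→L[ℂ] EuclideanSpace ℂ (Fin n),
        (∀ y, H y = A fun _ => y) ∧ J A}
      add_mem' := by
        rintro _ _ ⟨A, h1, h2⟩ ⟨B, h3, h4⟩
        exact ⟨A + B, fun y => by simp [h1, h3], hadd A B h2 h4⟩
      zero_mem' := ⟨0, fun y => by simp, hzero⟩
      smul_mem' := by
        rintro c _ ⟨A, h1, h2⟩
        exact ⟨c • A, fun y => by simp [h1], hsmul c A h2⟩ }
  have hcoord : ∀ (f : Fin (k + 2) → Fin n) (i : Fin n),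
      ∃ A : EuclideanSpace ℂ (Fin n) [×k + 2]→L[ℂ] EuclideanSpace ℂ (Fin n),
        ∀ y : EuclideanSpace ℂ (Fin n), (A fun _ => y) = (∏ l, y (f l)) • EuclideanSpace.single i (1 : ℂ) := fun f i =>
    ⟨((ContinuousMultilinearMap.mkPiAlgebra ℂ (Fin (k + 2)) ℂ).compContinuousLinearMap
      fun l => (EuclideanSpace.proj (f l) : EuclideanSpace ℂ (Fin n) →L[ℂ] ℂ)).smulRight (EuclideanSpace.single i 1),
      fun y => by simp⟩
  have happly : ∀ j, Tendsto (fun z : EuclideanSpace ℂ (Fin n) => z j) (𝓝 q) (𝓝 (q j)) := fun j =>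
    (by fun_prop : Continuous fun z : EuclideanSpace ℂ (Fin n) => z j).tendsto q
  have hle : ∀ j, (fun z : EuclideanSpace ℂ (Fin n) => z j - q j) =O[𝓝 q] fun z => z - q := fun j =>
    IsBigO.of_bound 1 (.of_forall fun z => by simpa using PiLp.norm_apply_le (z - q) j)
  have hsh : ∀ i j, i ≠ j → (fun y : EuclideanSpace ℂ (Fin n) => y j ^ (k + 1 + 1) • EuclideanSpace.single i 1) ∈ W := by
    intro i j hij
    obtain ⟨A, hA⟩ := hcoord (fun _ => j) i
    refine ⟨A, fun y => by simp [hA], ?_⟩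
    refine (nearId_shear hR ha N (k + 2) 1 hij (hq j)).mono ?_
    rintro σ - ⟨h, -, h1, h2⟩
    have h3 : (fun z : EuclideanSpace ℂ (Fin n) => h (z j) - 1 * (z j - q j) ^ (k + 2)) =o[𝓝 q]
        fun z => ‖z - q‖ ^ (k + 2) :=
      (h1.comp_tendsto (happly j)).trans_isBigO (((hle j).norm_right.pow _))
    have h4 := h3.smul_isBigO
      (isBigO_const_const (EuclideanSpace.single i (1 : ℂ)) (one_ne_zero (α := ℝ)) _)
    simp only [smul_eq_mul, mul_one] at h4
    refine h4.congr_left fun z => ?_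
    simp [hA, h2, sub_smul]
  have hov : ∀ i j, i ≠ j →
      (fun y : EuclideanSpace ℂ (Fin n) => (y j ^ (k + 1) * y i) • EuclideanSpace.single i 1) ∈ W := by
    intro i j hij
    obtain ⟨A, hA⟩ := hcoord (Fin.cons i fun _ => j) i
    have hA' : ∀ y : EuclideanSpace ℂ (Fin n), (A fun _ => y) = (y j ^ (k + 1) * y i) • EuclideanSpace.single i (1 : ℂ) :=
      fun y => by rw [hA, Fin.prod_univ_succ]; simp [mul_comm]
    refine ⟨A, fun y => (hA' y).symm, ?_⟩
    refine (nearId_overshear hR ha N (k + 1) 1 (q i) hij (hq j)).mono ?_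
    rintro σ - ⟨h, hcd, h1, h2⟩
    have h0 : h (q j) = 0 := eq_zero_of_isLittleO (by omega) h1
    have hh : h =O[𝓝 (q j)] fun w => (w - q j) ^ (k + 1) :=
      (h1.isBigO.add (isBigO_const_mul_self 1 _ _)).congr_left fun w => by ring
    have hexp : (fun w => Complex.exp (h w) - 1 - h w) =o[𝓝 (q j)] h := by
      have := (Complex.hasDerivAt_exp 0).isLittleO.comp_tendsto
        (show Tendsto h (𝓝 (q j)) (𝓝 0) by simpa [h0] using hcd.continuous.tendsto (q j))
      simpa [Function.comp_def] using this
    have h3 : (fun w => Complex.exp (h w) - 1 - 1 * (w - q j) ^ (k + 1)) =o[𝓝 (q j)]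
        fun w => (w - q j) ^ (k + 1) :=
      ((hexp.trans_isBigO hh).add h1).congr_left fun w => by ring
    have h4 : (fun z : EuclideanSpace ℂ (Fin n) => Complex.exp (h (z j)) - 1 - 1 * (z j - q j) ^ (k + 1)) =o[𝓝 q]
        fun z => ‖z - q‖ ^ (k + 1) :=
      (h3.comp_tendsto (happly j)).trans_isBigO (((hle j).norm_right.pow _))
    have h5 := (h4.mul_isBigO (hle i).norm_right).smul_isBigO
      (isBigO_const_const (EuclideanSpace.single i (1 : ℂ)) (one_ne_zero (α := ℝ)) _)
    simp only [smul_eq_mul, mul_one, ← pow_succ] at h5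
    refine h5.congr_left fun z => ?_
    rw [hA', h2, add_sub_cancel_left, ← sub_smul]
    congr 1
    simp
    ring
  have hWconj : ∀ M : EuclideanSpace ℂ (Fin n) ≃L[ℂ] EuclideanSpace ℂ (Fin n), ∀ H ∈ W, (fun y => M.symm (H (M y))) ∈ W := by
    rintro M H ⟨A, h1, h2⟩
    refine ⟨(M.symm : EuclideanSpace ℂ (Fin n) →L[ℂ] EuclideanSpace ℂ (Fin n)).compContinuousMultilinearMap
      (A.compContinuousLinearMap fun _ => (M : EuclideanSpace ℂ (Fin n) →L[ℂ] EuclideanSpace ℂ (Fin n))), fun y => by simp [h1], ?_⟩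
    exact hconj M A _ (fun y => by simp) h2
  obtain ⟨B, h1, h2⟩ := multilinear_diag_mem W hn hsh hov hWconj A.toMultilinearMap
  refine h2.mono fun σ _ h3 => ?_
  have h1' : ∀ y, (A fun _ => y) = B fun _ => y := h1
  simpa only [HasLeadingJet, h1'] using h3

end LeadingJets

section JetMatching

open Topology
open scoped ContDiff

variable {E : Type*} [NormedAddCommGroup E] [NormedSpace ℂ E]

lemma multilinear_diag_eq_zero {k : ℕ} (A : E [×k]→L[ℂ] E)
    (h : (fun y => A fun _ => y) =o[𝓝 0] fun y : E => ‖y‖ ^ k) (y : E) : (A fun _ => y) = 0 := by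
  have key : ∀ c > 0, ‖A fun _ => y‖ ≤ c * ‖y‖ ^ k := by
    intro c hc
    have hc' : Tendsto (fun t : ℂ => t • y) (𝓝[≠] 0) (𝓝 0) := by
      have : Tendsto (fun t : ℂ => t • y) (𝓝 0) (𝓝 ((0 : ℂ) • y)) :=
        (by fun_prop : Continuous fun t : ℂ => t • y).tendsto 0
      rw [zero_smul] at this
      exact this.mono_left nhdsWithin_le_nhds
    obtain ⟨t, ht, ht0⟩ := ((hc'.eventually (isLittleO_iff.mp h hc)).and
      self_mem_nhdsWithin).exists
    have ht0' : 0 < ‖t‖ := norm_pos_iff.mpr ht0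
    have h1 := A.map_smul_univ (fun _ => t) fun _ => y
    simp only [Finset.prod_const, Finset.card_univ, Fintype.card_fin] at h1
    rw [h1, norm_smul, norm_pow, norm_pow, norm_norm, norm_smul, mul_pow, mul_left_comm] at ht
    exact le_of_mul_le_mul_left ht (by positivity)
  refine norm_le_zero_iff.mp (le_of_forall_pos_le_add fun ε hε => ?_)
  have h2 := key (ε / (‖y‖ ^ k + 1)) (by positivity)
  rw [zero_add]
  refine h2.trans ?_
  rw [div_mul_eq_mul_div, div_le_iff₀ (by positivity)]
  nlinarith

lemma AnalyticAt.exists_leading_term {f : E → E} {q : E} (hf : AnalyticAt ℂ f q) {k : ℕ}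
    (h : f =o[𝓝 q] fun z => ‖z - q‖ ^ k) :
    ∃ A : E [×k + 1]→L[ℂ] E,
      (fun z => f z - A fun _ => z - q) =o[𝓝 q] fun z => ‖z - q‖ ^ (k + 1) := by
  obtain ⟨p, hp⟩ := hf
  have hq : Tendsto (fun y => q + y) (𝓝 0) (𝓝 q) := by
    simpa using (continuous_const_add q).tendsto 0
  have h' : (fun y => f (q + y)) =o[𝓝 0] fun y => ‖y‖ ^ k := by
    simpa [Function.comp_def] using h.comp_tendsto hq
  have hpow : ∀ {a b : ℕ}, a ≤ b → (fun y : E => ‖y‖ ^ b) =O[𝓝 0] fun y : E => ‖y‖ ^ a := by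
    intro a b hab
    obtain ⟨c, rfl⟩ := Nat.exists_eq_add_of_le hab
    have h1 : (fun y : E => ‖y‖ ^ c) =O[𝓝 0] fun _ => (1 : ℝ) :=
      ((by fun_prop : Continuous fun y : E => ‖y‖ ^ c).tendsto 0).isBigO_one ℝ
    simpa [pow_add] using (isBigO_refl (fun y : E => ‖y‖ ^ a) (𝓝 0)).mul h1
  have hlt : ∀ a : ℕ, (fun y : E => ‖y‖ ^ (a + 1)) =o[𝓝 0] fun y : E => ‖y‖ ^ a := fun a =>
    (isLittleO_pow_pow (𝕜 := ℝ) (Nat.lt_succ_self a)).comp_tendsto (by simpa using tendsto_norm_zero)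
  have hzero : ∀ m ≤ k, ∀ y, (p m fun _ => y) = 0 := by
    intro m
    induction m using Nat.strong_induction_on with
    | _ m ih =>
      intro hm
      refine multilinear_diag_eq_zero (p m) ?_
      have h1 : ∀ y, p.partialSum (m + 1) y = p m fun _ => y := fun y => by
        rw [FormalMultilinearSeries.partialSum, Finset.sum_range_succ, Finset.sum_eq_zero, zero_add]
        intro i hi
        have := Finset.mem_range.mp hi
        exact ih i this (by omega) y
      have h2 := (hp.isBigO_sub_partialSum_pow (m + 1)).trans_isLittleO (hlt m)
      refine ((h'.trans_isBigO (hpow hm)).sub h2).congr_left fun y => ?_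
      simp only [h1]
      abel
  refine ⟨p (k + 1), ?_⟩
  have h1 : ∀ y, p.partialSum (k + 2) y = p (k + 1) fun _ => y := fun y => by
    rw [FormalMultilinearSeries.partialSum, Finset.sum_range_succ, Finset.sum_eq_zero, zero_add]
    intro i hi
    have := Finset.mem_range.mp hi
    exact hzero i (by omega) y
  have h2 := (hp.isBigO_sub_partialSum_pow (k + 2)).trans_isLittleO (hlt (k + 1))
  simp only [h1] at h2
  have hq' : Tendsto (fun z => z - q) (𝓝 q) (𝓝 0) := tendsto_sub_nhds_zero_iff.mpr tendsto_id
  simpa [Function.comp_def] using h2.comp_tendsto hq'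

lemma jetAut.exists_hasFDerivAt {ι : Type*} {a : ι → E} {N : ℕ} {σ : Equiv.Perm E}
    (hσ : σ ∈ jetAut a N) (q : E) : ∃ M : E ≃L[ℂ] E, HasFDerivAt σ (M : E →L[ℂ] E) q := by
  have h1 := ((jetAut.contDiff hσ).differentiable (by simp) q).hasFDerivAt
  have h2 := ((jetAut.contDiff_inv hσ).differentiable (by simp) (σ q)).hasFDerivAt
  have h3 : (fderiv ℂ (σ⁻¹ : Equiv.Perm E) (σ q)).comp (fderiv ℂ σ q) =
      ContinuousLinearMap.id ℂ E := by
    refine (h2.comp q h1).unique ((hasFDerivAt_id q).congr_of_eventuallyEq (.of_forall ?_))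
    intro z
    simp
  have h4 : (fderiv ℂ σ q).comp (fderiv ℂ (σ⁻¹ : Equiv.Perm E) (σ q)) =
      ContinuousLinearMap.id ℂ E := by
    have h1' : HasFDerivAt σ (fderiv ℂ σ q) ((σ⁻¹ : Equiv.Perm E) (σ q)) := by simpa using h1
    refine (h1'.comp (σ q) h2).unique
      ((hasFDerivAt_id (σ q)).congr_of_eventuallyEq (.of_forall ?_))
    intro z
    simp
  exact ⟨ContinuousLinearEquiv.equivOfInverse _ _ (fun x => DFunLike.congr_fun h3 x)
    fun x => DFunLike.congr_fun h4 x, h1⟩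

variable {n : ℕ} {ι : Type*} [Fintype ι] {a : ι → EuclideanSpace ℂ (Fin n)} {R : ℝ}

/-- One order of contact can be gained by an automorphism close to the identity. -/
lemma nearId_improve_contact (hn : 2 ≤ n) (hR : 0 < R) (ha : ∀ j, ‖a j‖ < R) (N : ℕ)
    {q : EuclideanSpace ℂ (Fin n)} (hq : ∀ i, R ≤ ‖q i‖)
    {g : EuclideanSpace ℂ (Fin n) → EuclideanSpace ℂ (Fin n)} (hg : ContDiff ℂ ω g) {k : ℕ}
    (h : (fun z => g z - z) =o[𝓝 q] fun z => ‖z - q‖ ^ (k + 1)) :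
    NearId (jetAut a N) (Metric.ball 0 R) fun σ =>
      (fun z => σ z - g z) =o[𝓝 q] fun z => ‖z - q‖ ^ (k + 2) := by
  have hf : ContDiff ℂ ω fun z => g z - z := by fun_prop
  obtain ⟨A, hA⟩ := AnalyticAt.exists_leading_term hf.contDiffAt.analyticAt h
  refine (nearId_hasLeadingJet hn hR ha N hq A).mono fun σ _ hσ => ?_
  exact (IsLittleO.sub hσ hA).congr_left fun z => by abel

/-- Every jet of a local biholomorphism between far away points is the jet of an automorphism
close to the identity. -/
lemma nearId_match_jet (hn : 2 ≤ n) (hR : 0 < R) (ha : ∀ j, ‖a j‖ < R) (N : ℕ)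
    {p : EuclideanSpace ℂ (Fin n)} (hp : ∀ i, R ≤ ‖p i‖)
    {F : EuclideanSpace ℂ (Fin n) → EuclideanSpace ℂ (Fin n)} (hF : ContDiff ℂ ω F)
    (hq : ∀ i, R ≤ ‖F p i‖) {M : EuclideanSpace ℂ (Fin n) ≃L[ℂ] EuclideanSpace ℂ (Fin n)}
    (hM : HasFDerivAt F (M : EuclideanSpace ℂ (Fin n) →L[ℂ] EuclideanSpace ℂ (Fin n)) p) (k : ℕ) :
    NearId (jetAut a N) (Metric.ball 0 R) fun σ =>
      (fun z => σ z - F z) =o[𝓝 p] fun z => ‖z - p‖ ^ (k + 1) := by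
  induction k with
  | zero =>
    refine NearId.mul (T₂ := fun σ τ => τ (F p) = F p ∧ ∃ D : EuclideanSpace ℂ (Fin n) ≃L[ℂ] _,
      HasFDerivAt σ (D : EuclideanSpace ℂ (Fin n) →L[ℂ] EuclideanSpace ℂ (Fin n)) p ∧
      HasFDerivAt τ ((D.symm.trans M : EuclideanSpace ℂ (Fin n) ≃L[ℂ] EuclideanSpace ℂ (Fin n)) :
        EuclideanSpace ℂ (Fin n) →L[ℂ] EuclideanSpace ℂ (Fin n)) (F p))
      Metric.isOpen_ball (nearId_apply_eq hn hR ha N hp hq) ?_ ?_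
    · intro σ hσ h1
      obtain ⟨D, hD⟩ := jetAut.exists_hasFDerivAt hσ p
      exact (nearId_hasFDerivAt hn hR ha N hq (D.symm.trans M)).mono
        fun τ _ h2 => ⟨h2.1, D, hD, h2.2⟩
    · rintro σ - τ - h1 ⟨h2, D, h3, h4⟩
      rw [← h1] at h4
      have h5 := (h4.comp p h3).isLittleO.sub hM.isLittleO
      simp only [zero_add, pow_one]
      refine (h5.congr_left fun z => ?_).norm_right
      simp [h1, h2]
  | succ k ih =>
    refine NearId.mul (T₂ := fun σ τ => (fun z => τ z - F (σ⁻¹ z)) =o[𝓝 (F p)]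
      fun z => ‖z - F p‖ ^ (k + 2)) Metric.isOpen_ball ih ?_ ?_
    · intro σ hσ h1
      have h0 : σ p = F p := by
        simpa [sub_eq_zero] using (isLittleO_iff.mp h1 one_pos).self_of_nhds
      have h0' : σ⁻¹ (F p) = p := by simp [← h0]
      have hd := (jetAut.contDiff_inv hσ).differentiable (by simp) (F p)
      have hc : Tendsto (σ⁻¹ : Equiv.Perm _) (𝓝 (F p)) (𝓝 p) := by
        simpa only [h0'] using hd.continuousAt.tendsto
      have h2 : (fun z => σ⁻¹ z - p) =O[𝓝 (F p)] fun z => z - F p := by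
        simpa only [h0'] using hd.isBigO_sub
      refine nearId_improve_contact hn hR ha N hq (hF.comp (jetAut.contDiff_inv hσ)) ?_
      refine ((h1.comp_tendsto hc).trans_isBigO (h2.norm_norm.pow _)).neg_left.congr_left
        fun z => ?_
      simp
    · intro σ hσ τ _ h1 h2
      have h0 : σ p = F p := by
        simpa [sub_eq_zero] using (isLittleO_iff.mp h1 one_pos).self_of_nhds
      have hd := (jetAut.contDiff hσ).differentiable (by simp) p
      have hc : Tendsto σ (𝓝 p) (𝓝 (F p)) := by
        simpa only [h0] using hd.continuousAt.tendsto
      have h3 : (fun z => σ z - F p) =O[𝓝 p] fun z => z - p := by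
        simpa only [h0] using hd.isBigO_sub
      refine ((h2.comp_tendsto hc).trans_isBigO (h3.norm_norm.pow _)).congr_left fun z => ?_
      simp

end JetMatching

/-- Automorphisms with prescribed jets at finitely many points (Andersén–Lempert,
Forstnerič): given a compact polynomially convex set K, finitely many points a₁,…,a_s ∈ K,
points p, q ∉ K, and a polynomial map P with P(0)=0 and nondegenerate linear part, there is
an automorphism Φ of ℂⁿ with Φ(p) = q, prescribed m-jet P at p, identity N-jet at each a_j,
and ε-close to the identity on K together with its inverse. -/
theorem automorphism_with_prescribed_jets (m n N s : ℕ) (hn : 2 ≤ n)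
    (K : Set (EuclideanSpace ℂ (Fin n))) (hK : IsCompact K) (hKpc : IsPolynomiallyConvex K)
    (a : Fin s → EuclideanSpace ℂ (Fin n)) (ha : ∀ j, a j ∈ K)
    (p q : EuclideanSpace ℂ (Fin n)) (hp : p ∉ K) (hq : q ∉ K)
    (P : EuclideanSpace ℂ (Fin n) → EuclideanSpace ℂ (Fin n))
    (hPpoly : ∃ Q : Fin n → MvPolynomial (Fin n) ℂ,
      ∀ (z : EuclideanSpace ℂ (Fin n)) (i : Fin n),
        P z i = MvPolynomial.eval (fun j => z j) (Q i))
    (hP0 : P 0 = 0)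
    (hPlin : ∃ A : EuclideanSpace ℂ (Fin n) ≃L[ℂ] EuclideanSpace ℂ (Fin n),
      fderiv ℂ P 0 = (A : EuclideanSpace ℂ (Fin n) →L[ℂ] EuclideanSpace ℂ (Fin n)))
    (ε : ℝ) (hε : 0 < ε) :
    ∃ Φ G : EuclideanSpace ℂ (Fin n) → EuclideanSpace ℂ (Fin n),
      Differentiable ℂ Φ ∧ Differentiable ℂ G ∧
      (∀ z, G (Φ z) = z) ∧ (∀ z, Φ (G z) = z) ∧
      Φ p = q ∧
      (fun z => Φ z - q - P (z - p)) =O[nhds p] (fun z => ‖z - p‖ ^ (m + 1)) ∧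
      (∀ j : Fin s,
        (fun z => Φ z - z) =O[nhds (a j)] (fun z => ‖z - a j‖ ^ N)) ∧
      (∀ z ∈ K, ‖Φ z - z‖ + ‖G z - z‖ < ε) := by
  obtain ⟨Q, hQ⟩ := hPpoly
  obtain ⟨A, hA⟩ := hPlin
  have hP : ContDiff ℂ ⊤ P := contDiff_euclidean.mpr fun i => IsPolyFun.contDiff ⟨Q i, fun z => hQ z i⟩
  obtain ⟨R₀, hR₀⟩ := hK.isBounded.exists_norm_le
  set R₁ := max R₀ 0 with hR₁
  have hKR : ∀ z ∈ K, ‖z‖ ≤ R₁ := fun z hz => (hR₀ z hz).trans (le_max_left _ _)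
  have hR₁0 : 0 ≤ R₁ := le_max_right _ _
  set R := R₁ + 1 with hR
  have hR0 : 0 < R := by positivity
  have haR : ∀ j, ‖a j‖ < R := fun j => (hKR _ (ha j)).trans_lt (lt_add_one _)
  let c : EuclideanSpace ℂ (Fin n) := WithLp.toLp 2 fun _ => ((R + 1 : ℝ) : ℂ)
  have hci : ∀ i, ‖c i‖ = R + 1 := fun i => by
    simp only [c]
    rw [Complex.norm_real, Real.norm_of_nonneg (by positivity)]
  have hc : R₁ < ‖c‖ := by
    have h1 := PiLp.norm_apply_le c ⟨0, by omega⟩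
    rw [hci] at h1
    linarith
  have hfar : ∀ x : EuclideanSpace ℂ (Fin n), ‖x - c‖ < 1 → ∀ i, R ≤ ‖x i‖ := by
    intro x hx i
    have h1 : ‖x i - c i‖ < 1 := (PiLp.norm_apply_le (x - c) i).trans_lt hx
    have h2 := norm_sub_norm_le (c i) (x i)
    rw [norm_sub_rev, hci] at h2
    linarith
  obtain ⟨U₁, hU₁, hKU₁, hpush₁⟩ := hKpc.exists_pushesTo_far hn hK a ha N hp hR₁0 hKR hc
  obtain ⟨U₂, hU₂, hKU₂, hpush₂⟩ := hKpc.exists_pushesTo_far hn hK a ha N hq hR₁0 hKR hc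
  set V := U₁ ∩ U₂ ∩ Metric.ball 0 R with hV
  have hVo : IsOpen V := IsOpen.inter (IsOpen.inter hU₁ hU₂) Metric.isOpen_ball
  have hKV : K ⊆ V := fun z hz => ⟨⟨hKU₁ hz, hKU₂ hz⟩, by
    simpa using (hKR z hz).trans_lt (lt_add_one _)⟩
  obtain ⟨L, hLV, hL, δ, hδ, hmul⟩ := exists_closeToId_mul hVo hK hKV (half_pos hε)
  obtain ⟨L', hLV', hL', δ', hδ', hmul'⟩ := exists_closeToId_mul hVo hL hLV hδ
  obtain ⟨σ, hσ, hσp, hσL⟩ := hpush₁ 1 one_pos L' (fun z hz => (hLV' hz).1.1) hL' δ' hδ'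
  obtain ⟨τ, hτ, hτq, hτL⟩ := hpush₂ 1 one_pos L (fun z hz => (hLV hz).1.2) hL δ hδ
  let F : EuclideanSpace ℂ (Fin n) → EuclideanSpace ℂ (Fin n) := fun z => τ (q + P (σ⁻¹ z - p))
  have hFp : F (σ p) = τ q := by simp [F, hP0]
  have hF : ContDiff ℂ ⊤ F := by
    refine (jetAut.contDiff hτ).comp (contDiff_const.add (hP.comp ?_))
    exact (jetAut.contDiff_inv hσ).sub contDiff_const
  obtain ⟨D₁, hD₁⟩ := jetAut.exists_hasFDerivAt hσ p
  obtain ⟨D₂, hD₂⟩ := jetAut.exists_hasFDerivAt hτ q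
  have hFd : HasFDerivAt F ((D₁.symm.trans (A.trans D₂) :
      EuclideanSpace ℂ (Fin n) ≃L[ℂ] EuclideanSpace ℂ (Fin n)) :
        EuclideanSpace ℂ (Fin n) →L[ℂ] EuclideanSpace ℂ (Fin n)) (σ p) := by
    have h1 := (jetAut.hasStrictFDerivAt_inv hσ hD₁).hasFDerivAt
    have h2 : HasFDerivAt P (A : EuclideanSpace ℂ (Fin n) →L[ℂ] EuclideanSpace ℂ (Fin n))
        (σ⁻¹ (σ p) - p) := by
      simp only [Equiv.Perm.inv_def, Equiv.symm_apply_apply, sub_self]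
      rw [← hA]
      exact (hP.differentiable (by simp) 0).hasFDerivAt
    have h3 : HasFDerivAt τ (D₂ : EuclideanSpace ℂ (Fin n) →L[ℂ] EuclideanSpace ℂ (Fin n))
        (q + P (σ⁻¹ (σ p) - p)) := by simpa [hP0] using hD₂
    exact h3.comp (σ p) ((h2.comp (σ p) (h1.sub_const p)).const_add q)
  obtain ⟨θ, hθ, hθF, hθL⟩ := nearId_match_jet hn hR0 haR N (hfar _ hσp) hF
    (by rw [hFp]; exact hfar _ hτq) hFd m L' (fun z hz => (hLV' hz).2) hL' δ' hδ'
  have hθp : θ (σ p) = τ q := by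
    rw [← hFp]
    simpa [sub_eq_zero] using (isLittleO_iff.mp hθF one_pos).self_of_nhds
  have hmem : τ⁻¹ * (θ * σ) ∈ jetAut a N :=
    Subgroup.mul_mem _ (Subgroup.inv_mem _ hτ) (Subgroup.mul_mem _ hθ hσ)
  have hclose := hmul _ _ hτL.inv (hmul' _ _ hθL hσL)
  refine ⟨(τ⁻¹ * (θ * σ) : Equiv.Perm _), ((τ⁻¹ * (θ * σ))⁻¹ : Equiv.Perm _),
    (jetAut.contDiff hmem).differentiable (by simp),
    (jetAut.contDiff_inv hmem).differentiable (by simp), fun z => Equiv.symm_apply_apply _ z,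
    fun z => Equiv.apply_symm_apply _ z, ?_, ?_, fun j => ?_, fun z hz => ?_⟩
  · simp [hθp]
  · have hdσ := (jetAut.contDiff hσ).differentiable (by simp) p
    have h1 : (fun z => θ (σ z) - F (σ z)) =o[nhds p] fun z => ‖z - p‖ ^ (m + 1) :=
      (hθF.comp_tendsto hdσ.continuousAt.tendsto).trans_isBigO (hdσ.isBigO_sub.norm_norm.pow _)
    have h2 : Tendsto (fun z => (θ (σ z), F (σ z))) (nhds p) (nhds (τ q, τ q)) := by
      refine Tendsto.prodMk_nhds ?_ ?_
      · rw [← hθp]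
        exact ((jetAut.contDiff hθ).continuous.comp (jetAut.contDiff hσ).continuous).tendsto p
      · rw [← hFp]
        exact (hF.continuous.comp (jetAut.contDiff hσ).continuous).tendsto p
    have h3 := ((jetAut.hasStrictFDerivAt_inv hτ hD₂).isBigO_sub.comp_tendsto h2).trans h1.isBigO
    refine h3.congr_left fun z => ?_
    simp [F, sub_sub]
  · refine (jetAut.isBigO hmem j).trans ?_
    have h1 : (fun z => ‖z - a j‖) =O[nhds (a j)] fun _ => (1 : ℝ) :=
      ((by fun_prop : Continuous fun z => ‖z - a j‖).tendsto (a j)).isBigO_one ℝ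
    simpa [pow_succ] using (isBigO_refl (fun z => ‖z - a j‖ ^ N) (nhds (a j))).mul h1
  · have := hclose z hz
    linarith [this.1, this.2]
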